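/- (Continuity of the solution map.) Assume hypotheses (H1)–(H3) and let q0, q be chosen with 1 − 1/p < 1/q0 < min{β, δα, δ/p, 1/2} and 1/(q0·δ) ≤ 1/q < min{α, 1/p}. For ω : [0,T] → ℝ^m continuous of finite p-variation, s ∈ [0,T] and z ∈ ℝ^d, denote by X(s,·,ω,z) : [0,T] → ℝ^d the unique path of finite q-variation solving both the forward equation X(s,t,ω,z) = z + ∫_s^t f(u,X(s,u,ω,z)) du + ∫_s^t g(u,X(s,u,ω,z)) dω_u for t ∈ [s,T] and the backward equation X(s,t,ω,z) = z − ∫_t^s f(u,X(s,u,ω,z)) du − ∫_t^s g(u,X(s,u,ω,z)) dω_u for t ∈ [0,s]; in particular X(s,s,ω,z) = z. Then the solution mapping X : [0,T] × [0,T] × Ĉ^p([0,T],ℝ^m) × ℝ^d → ℝ^d, (s,t,ω,z) ↦ X(s,t,ω,z), is continuous, where Ĉ^p([0,T],ℝ^m) carries the p-variation norm ‖ω‖_{p-var,[0,T]} = |ω_0| + |||ω|||_{p-var,[0,T]}. -/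

import Mathlib

open scoped BigOperators
open Set

noncomputable section

/-- Euclidean space `ℝ^n`. -/
abbrev Ed (n : ℕ) : Type := EuclideanSpace ℝ (Fin n)

section PVarDefs

variable {E F : Type*} [NormedAddCommGroup E] [NormedSpace ℝ E]
  [NormedAddCommGroup F] [NormedSpace ℝ F]

/-- The set of sums `Σ_i ‖x (t (i+1)) - x (t i)‖ ^ p` over all finite partitions
`a = t 0 < t 1 < ⋯ < t n = b` of `[a,b]`. -/
def pVarSums (p : ℝ) (x : ℝ → E) (a b : ℝ) : Set ℝ :=
  { v | ∃ n : ℕ, ∃ t : Fin (n + 1) → ℝ, StrictMono t ∧ t 0 = a ∧ t (Fin.last n) = b ∧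
      v = ∑ i : Fin n, ‖x (t i.succ) - x (t i.castSucc)‖ ^ p }

/-- The `p`-variation seminorm `|||x|||_{p-var,[a,b]}`. -/
def pVar (p : ℝ) (x : ℝ → E) (a b : ℝ) : ℝ :=
  sSup (pVarSums p x a b) ^ (1 / p)

/-- `x` is of finite `p`-variation on `[a,b]`. -/
def FinitePVar (p : ℝ) (x : ℝ → E) (a b : ℝ) : Prop :=
  BddAbove (pVarSums p x a b)

/-- The `p`-variation norm `‖x‖_{p-var,[a,b]} = ‖x a‖ + |||x|||_{p-var,[a,b]}`. -/
def pVarNorm (p : ℝ) (x : ℝ → E) (a b : ℝ) : ℝ :=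
  ‖x a‖ + pVar p x a b

/-- A control function on `[a,b]`: continuous on the simplex, vanishing on the diagonal,
superadditive and nonnegative. -/
def IsControlOn (a b : ℝ) (w : ℝ → ℝ → ℝ) : Prop :=
  ContinuousOn (fun pr : ℝ × ℝ => w pr.1 pr.2) {pr : ℝ × ℝ | a ≤ pr.1 ∧ pr.1 ≤ pr.2 ∧ pr.2 ≤ b} ∧
  (∀ t : ℝ, a ≤ t → t ≤ b → w t t = 0) ∧
  (∀ s t u : ℝ, a ≤ s → s ≤ t → t ≤ u → u ≤ b → w s t + w t u ≤ w s u) ∧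
  (∀ s t : ℝ, a ≤ s → s ≤ t → t ≤ b → 0 ≤ w s t)

/-- A tagged partition `a = t 0 < t 1 < ⋯ < t n = b` of `[a,b]`, with tags
`tag i ∈ [t i, t (i+1)]`. -/
structure TaggedPartition (a b : ℝ) where
  n : ℕ
  t : Fin (n + 1) → ℝ
  tag : Fin n → ℝ
  mono : StrictMono t
  first : t 0 = a
  last : t (Fin.last n) = b
  tag_mem : ∀ i : Fin n, tag i ∈ Set.Icc (t i.castSucc) (t i.succ)

/-- The mesh of a tagged partition. -/
def TaggedPartition.mesh {a b : ℝ} (P : TaggedPartition a b) : ℝ :=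
  ⨆ i : Fin P.n, (P.t i.succ - P.t i.castSucc)

/-- Riemann–Stieltjes sum of `x` against `ω` along a tagged partition. -/
def RSSum (x : ℝ → E →L[ℝ] F) (ω : ℝ → E) {a b : ℝ} (P : TaggedPartition a b) : F :=
  ∑ i : Fin P.n, x (P.tag i) (ω (P.t i.succ) - ω (P.t i.castSucc))

/-- `v` is the Young integral `∫_a^b x dω`: the Riemann–Stieltjes sums converge to `v`
as the mesh tends to `0`. -/
def IsYoungIntegral (x : ℝ → E →L[ℝ] F) (ω : ℝ → E) (a b : ℝ) (v : F) : Prop :=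
  ∀ ε : ℝ, 0 < ε → ∃ δ : ℝ, 0 < δ ∧
    ∀ P : TaggedPartition a b, P.mesh < δ → ‖RSSum x ω P - v‖ < ε

/-- The Young integral `∫_a^b x dω` (an arbitrary value, `0`, if the limit does not exist). -/
def youngIntegral (x : ℝ → E →L[ℝ] F) (ω : ℝ → E) (a b : ℝ) : F :=
  letI := Classical.propDecidable (∃ v, IsYoungIntegral x ω a b v)
  if hv : ∃ v, IsYoungIntegral x ω a b v then hv.choose else 0

end PVarDefs

/-! ### Superadditive controls -/

/-- A nonnegative superadditive function on the simplex over `[a, b]`. -/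
structure IsCtrl (a b : ℝ) (w : ℝ → ℝ → ℝ) : Prop where
  nonneg : ∀ u v, a ≤ u → u ≤ v → v ≤ b → 0 ≤ w u v
  superadd : ∀ u t v, a ≤ u → u ≤ t → t ≤ v → v ≤ b → w u t + w t v ≤ w u v

namespace IsCtrl

variable {a b : ℝ} {w w₁ w₂ : ℝ → ℝ → ℝ}

theorem restrict (hw : IsCtrl a b w) {a' b' : ℝ} (ha : a ≤ a') (hb : b' ≤ b) :
    IsCtrl a' b' w :=
  ⟨fun u v hu huv hv => hw.nonneg u v (ha.trans hu) huv (hv.trans hb),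
    fun u t v hu hut htv hv => hw.superadd u t v (ha.trans hu) hut htv (hv.trans hb)⟩

theorem mono (hw : IsCtrl a b w) {u v u' v' : ℝ} (h1 : a ≤ u') (h2 : u' ≤ u) (h3 : u ≤ v)
    (h4 : v ≤ v') (h5 : v' ≤ b) : w u v ≤ w u' v' := by
  have e1 := hw.superadd u' u v h1 h2 h3 (h4.trans h5)
  have e2 := hw.superadd u' v v' h1 (h2.trans h3) h4 h5
  have e3 := hw.nonneg u' u h1 h2 ((h3.trans h4).trans h5)
  have e4 := hw.nonneg v v' (h1.trans (h2.trans h3)) h4 h5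
  linarith

theorem sub : IsCtrl a b (fun u v => v - u) :=
  ⟨fun u v _ h _ => sub_nonneg.2 h, fun u t v _ _ _ _ => by linarith⟩

theorem add (h₁ : IsCtrl a b w₁) (h₂ : IsCtrl a b w₂) :
    IsCtrl a b (fun u v => w₁ u v + w₂ u v) :=
  ⟨fun u v hu huv hv => add_nonneg (h₁.nonneg u v hu huv hv) (h₂.nonneg u v hu huv hv),
    fun u t v hu hut htv hv => by
      have := h₁.superadd u t v hu hut htv hv
      have := h₂.superadd u t v hu hut htv hv
      linarith⟩

theorem const_mul (hw : IsCtrl a b w) {c : ℝ} (hc : 0 ≤ c) :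
    IsCtrl a b (fun u v => c * w u v) :=
  ⟨fun u v hu huv hv => mul_nonneg hc (hw.nonneg u v hu huv hv),
    fun u t v hu hut htv hv => by
      have := mul_le_mul_of_nonneg_left (hw.superadd u t v hu hut htv hv) hc
      linarith⟩

theorem rpow (hw : IsCtrl a b w) {θ : ℝ} (hθ : 1 ≤ θ) :
    IsCtrl a b (fun u v => w u v ^ θ) :=
  ⟨fun u v hu huv hv => Real.rpow_nonneg (hw.nonneg u v hu huv hv) θ,
    fun u t v hu hut htv hv => by
      have h1 := hw.nonneg u t hu hut (htv.trans hv)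
      have h2 := hw.nonneg t v (hu.trans hut) htv hv
      exact (Real.add_rpow_le_rpow_add h1 h2 hθ).trans
        (Real.rpow_le_rpow (add_nonneg h1 h2) (hw.superadd u t v hu hut htv hv)
          (zero_le_one.trans hθ))⟩

theorem sum_le (hw : IsCtrl a b w) {t : ℕ → ℝ} (ht : Monotone t) (h0 : a ≤ t 0) (n : ℕ)
    (hn : t n ≤ b) : ∑ i ∈ Finset.range n, w (t i) (t (i + 1)) ≤ w (t 0) (t n) := by
  induction n with
  | zero => simpa using hw.nonneg (t 0) (t 0) h0 le_rfl hn
  | succ n ih =>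
    rw [Finset.sum_range_succ]
    have h1 := ih ((ht n.le_succ).trans hn)
    have h2 := hw.superadd (t 0) (t n) (t (n + 1)) h0 (ht n.zero_le) (ht n.le_succ) hn
    linarith

end IsCtrl

theorem rpow_mul_rpow_add_le {s t a₁ a₂ b₁ b₂ : ℝ} (hs : 0 < s) (ht : 0 < t) (hst : s + t = 1)
    (ha₁ : 0 ≤ a₁) (ha₂ : 0 ≤ a₂) (hb₁ : 0 ≤ b₁) (hb₂ : 0 ≤ b₂) :
    a₁ ^ s * b₁ ^ t + a₂ ^ s * b₂ ^ t ≤ (a₁ + a₂) ^ s * (b₁ + b₂) ^ t := by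
  rcases (add_nonneg ha₁ ha₂).eq_or_lt with hA | hA
  · have h1 : a₁ = 0 := by linarith
    have h2 : a₂ = 0 := by linarith
    simp [h1, h2, Real.zero_rpow hs.ne']
  rcases (add_nonneg hb₁ hb₂).eq_or_lt with hB | hB
  · have h1 : b₁ = 0 := by linarith
    have h2 : b₂ = 0 := by linarith
    simp [h1, h2, Real.zero_rpow ht.ne']
  have key : ∀ x y : ℝ, 0 ≤ x → 0 ≤ y → x ^ s * y ^ t ≤
      (s * (x / (a₁ + a₂)) + t * (y / (b₁ + b₂))) * ((a₁ + a₂) ^ s * (b₁ + b₂) ^ t) := by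
    intro x y hx hy
    have := Real.geom_mean_le_arith_mean2_weighted hs.le ht.le (div_nonneg hx hA.le)
      (div_nonneg hy hB.le) hst
    rw [Real.div_rpow hx hA.le, Real.div_rpow hy hB.le, div_mul_div_comm,
      div_le_iff₀ (by positivity)] at this
    exact this
  refine (add_le_add (key a₁ b₁ ha₁ hb₁) (key a₂ b₂ ha₂ hb₂)).trans (le_of_eq ?_)
  rw [← add_mul]
  have : s * (a₁ / (a₁ + a₂)) + t * (b₁ / (b₁ + b₂)) + (s * (a₂ / (a₁ + a₂)) +
      t * (b₂ / (b₁ + b₂))) = s + t := by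
    field_simp
    ring
  rw [this, hst, one_mul]

theorem IsCtrl.rpow_mul_rpow {a b s t : ℝ} {w₁ w₂ : ℝ → ℝ → ℝ} (h₁ : IsCtrl a b w₁)
    (h₂ : IsCtrl a b w₂) (hs : 0 < s) (ht : 0 < t) (hst : s + t = 1) :
    IsCtrl a b (fun u v => w₁ u v ^ s * w₂ u v ^ t) :=
  ⟨fun u v hu huv hv => mul_nonneg (Real.rpow_nonneg (h₁.nonneg u v hu huv hv) _)
      (Real.rpow_nonneg (h₂.nonneg u v hu huv hv) _),
    fun u r v hu hur hrv hv => by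
      have e1 := h₁.nonneg u r hu hur (hrv.trans hv)
      have e2 := h₁.nonneg r v (hu.trans hur) hrv hv
      have e3 := h₂.nonneg u r hu hur (hrv.trans hv)
      have e4 := h₂.nonneg r v (hu.trans hur) hrv hv
      refine (rpow_mul_rpow_add_le hs ht hst e1 e2 e3 e4).trans ?_
      exact mul_le_mul
        (Real.rpow_le_rpow (add_nonneg e1 e2) (h₁.superadd u r v hu hur hrv hv) hs.le)
        (Real.rpow_le_rpow (add_nonneg e3 e4) (h₂.superadd u r v hu hur hrv hv) ht.le)
        (Real.rpow_nonneg (add_nonneg e3 e4) _)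
        (Real.rpow_nonneg (h₁.nonneg u v hu (hur.trans hrv) hv) _)⟩

/-! ### The variation of a path -/

section Variation

variable {E : Type*} [NormedAddCommGroup E] {p a b c : ℝ} {x : ℝ → E}

theorem exists_seq_of_strictMono {n : ℕ} {t : Fin (n + 1) → ℝ} (ht : StrictMono t) :
    ∃ τ : ℕ → ℝ, Monotone τ ∧ τ 0 = t 0 ∧ τ n = t (Fin.last n) ∧
      ∀ i : Fin n, τ i = t i.castSucc ∧ τ (i + 1) = t i.succ := by
  refine ⟨fun i => t ⟨min i n, by omega⟩, ?_, ?_, ?_, ?_⟩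
  · intro i j hij
    apply ht.monotone
    simp only [Fin.mk_le_mk]
    omega
  · simp
  · simp only [min_self]
    rfl
  · intro i
    constructor
    · refine congrArg t (Fin.ext ?_)
      simp only [Fin.val_castSucc]
      omega
    · refine congrArg t (Fin.ext ?_)
      simp only [Fin.val_succ]
      omega

theorem exists_seq_of_mem_pVarSums {A : ℝ} (hA : A ∈ pVarSums p x a b) :
    ∃ (n : ℕ) (t : ℕ → ℝ), Monotone t ∧ t 0 = a ∧ t n = b ∧
      A = ∑ i ∈ Finset.range n, ‖x (t (i + 1)) - x (t i)‖ ^ p := by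
  obtain ⟨n, t, ht, h0, hn, rfl⟩ := hA
  obtain ⟨τ, hτ, hτ0, hτn, hτi⟩ := exists_seq_of_strictMono ht
  refine ⟨n, τ, hτ, hτ0.trans h0, hτn.trans hn, ?_⟩
  rw [← Fin.sum_univ_eq_sum_range (fun i => ‖x (τ (i + 1)) - x (τ i)‖ ^ p)]
  exact Finset.sum_congr rfl fun i _ => by rw [(hτi i).1, (hτi i).2]

theorem zero_mem_pVarSums_self : (0 : ℝ) ∈ pVarSums p x a a :=
  ⟨0, fun _ => a, Subsingleton.strictMono (α := Fin 1) _, rfl, rfl, by simp⟩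

theorem pVarSums_snoc (hp : 0 < p) {A : ℝ} (hA : A ∈ pVarSums p x a b) (hbc : b ≤ c) :
    A + ‖x c - x b‖ ^ p ∈ pVarSums p x a c := by
  rcases hbc.eq_or_lt with rfl | hbc
  · simpa [Real.zero_rpow hp.ne'] using hA
  obtain ⟨n, t, ht, h0, hn, rfl⟩ := hA
  refine ⟨n + 1, Fin.snoc (α := fun _ => ℝ) t c, ?_, ?_, ?_, ?_⟩
  · rw [Fin.strictMono_iff_lt_succ]
    intro i
    refine Fin.lastCases ?_ (fun j => ?_) i
    · rw [Fin.snoc_castSucc, Fin.succ_last, Fin.snoc_last, hn]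
      exact hbc
    · rw [Fin.snoc_castSucc, Fin.succ_castSucc, Fin.snoc_castSucc]
      exact ht (Fin.castSucc_lt_succ)
  · rw [← h0, ← Fin.castSucc_zero, Fin.snoc_castSucc]
  · rw [Fin.snoc_last]
  · rw [Fin.sum_univ_castSucc]
    simp only [Fin.succ_castSucc, Fin.snoc_castSucc, Fin.succ_last, Fin.snoc_last, hn]

theorem pVarSums_append (hp : 0 < p) {A B : ℝ} (hA : A ∈ pVarSums p x a b)
    (hB : B ∈ pVarSums p x b c) : A + B ∈ pVarSums p x a c := by
  obtain ⟨n, t, ht, h0, hn, rfl⟩ := exists_seq_of_mem_pVarSums hB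
  have key : ∀ k, A + ∑ i ∈ Finset.range k, ‖x (t (i + 1)) - x (t i)‖ ^ p ∈
      pVarSums p x a (t k) := by
    intro k
    induction k with
    | zero => simpa [h0] using hA
    | succ k ih =>
      rw [Finset.sum_range_succ, ← add_assoc]
      exact pVarSums_snoc hp ih (ht k.le_succ)
  exact hn ▸ key n

theorem norm_rpow_mem_pVarSums (hp : 0 < p) (hab : a ≤ b) :
    ‖x b - x a‖ ^ p ∈ pVarSums p x a b := by
  simpa using pVarSums_snoc hp (zero_mem_pVarSums_self (p := p) (x := x) (a := a)) hab

theorem FinitePVar.mono (hp : 0 < p) (hx : FinitePVar p x a b) {u v : ℝ} (hu : a ≤ u)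
    (hv : v ≤ b) : FinitePVar p x u v := by
  obtain ⟨K, hK⟩ := hx
  refine ⟨K, fun A hA => ?_⟩
  have h1 := hK (pVarSums_snoc hp (pVarSums_append hp (norm_rpow_mem_pVarSums hp hu) hA) hv)
  have h2 : 0 ≤ ‖x u - x a‖ ^ p := by positivity
  have h3 : 0 ≤ ‖x b - x v‖ ^ p := by positivity
  linarith

/-- The `p`-th power of the `p`-variation seminorm. -/
def varSup (p : ℝ) (x : ℝ → E) (u v : ℝ) : ℝ := sSup (pVarSums p x u v)

theorem norm_rpow_le_varSup (hp : 0 < p) (hx : FinitePVar p x a b) {u v : ℝ} (hu : a ≤ u)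
    (huv : u ≤ v) (hv : v ≤ b) : ‖x v - x u‖ ^ p ≤ varSup p x u v :=
  le_csSup (hx.mono hp hu hv) (norm_rpow_mem_pVarSums hp huv)

theorem norm_le_varSup (hp : 0 < p) (hx : FinitePVar p x a b) {u v : ℝ} (hu : a ≤ u)
    (huv : u ≤ v) (hv : v ≤ b) : ‖x v - x u‖ ≤ varSup p x u v ^ (1 / p) := by
  have h1 := norm_rpow_le_varSup hp hx hu huv hv
  have h2 := Real.rpow_le_rpow (by positivity) h1 (one_div_nonneg.2 hp.le)
  rwa [← Real.rpow_mul (norm_nonneg _), mul_one_div_cancel hp.ne', Real.rpow_one] at h2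

theorem isCtrl_varSup (hp : 0 < p) (hx : FinitePVar p x a b) : IsCtrl a b (varSup p x) := by
  refine ⟨fun u v hu huv hv => ?_, fun u t v hu hut htv hv => ?_⟩
  · exact le_trans (by positivity) (norm_rpow_le_varSup hp hx hu huv hv)
  · rw [← le_sub_iff_add_le]
    refine csSup_le ⟨_, norm_rpow_mem_pVarSums hp hut⟩ fun A hA => ?_
    rw [le_sub_comm]
    refine csSup_le ⟨_, norm_rpow_mem_pVarSums hp htv⟩ fun B hB => ?_
    rw [le_sub_iff_add_le']
    exact le_csSup (hx.mono hp hu hv) (pVarSums_append hp hA hB)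

theorem IsCtrl.le_of_mem_pVarSums {w : ℝ → ℝ → ℝ} (hw : IsCtrl a b w)
    (hxw : ∀ u v, a ≤ u → u ≤ v → v ≤ b → ‖x v - x u‖ ^ p ≤ w u v) {A : ℝ}
    (hA : A ∈ pVarSums p x a b) : A ≤ w a b := by
  obtain ⟨n, t, ht, rfl, rfl, rfl⟩ := exists_seq_of_mem_pVarSums hA
  refine le_trans (Finset.sum_le_sum fun i hi => ?_) (hw.sum_le ht le_rfl n le_rfl)
  exact hxw _ _ (ht i.zero_le) (ht i.le_succ) (ht (Finset.mem_range.1 hi))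

theorem IsCtrl.finitePVar {w : ℝ → ℝ → ℝ} (hw : IsCtrl a b w)
    (hxw : ∀ u v, a ≤ u → u ≤ v → v ≤ b → ‖x v - x u‖ ^ p ≤ w u v) : FinitePVar p x a b :=
  ⟨w a b, fun _ hA => hw.le_of_mem_pVarSums hxw hA⟩

theorem IsCtrl.varSup_le {w : ℝ → ℝ → ℝ} (hp : 0 < p) (hab : a ≤ b) (hw : IsCtrl a b w)
    (hxw : ∀ u v, a ≤ u → u ≤ v → v ≤ b → ‖x v - x u‖ ^ p ≤ w u v) :
    varSup p x a b ≤ w a b :=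
  csSup_le ⟨_, norm_rpow_mem_pVarSums hp hab⟩ fun _ hA => hw.le_of_mem_pVarSums hxw hA

theorem FinitePVar.of_norm_le {c s : ℝ} {w : ℝ → ℝ → ℝ} (hp : 0 < p) (hw : IsCtrl a b w)
    (hc : 0 ≤ c) (hs : 1 ≤ s * p)
    (hxw : ∀ u v, a ≤ u → u ≤ v → v ≤ b → ‖x v - x u‖ ≤ c * w u v ^ s) :
    FinitePVar p x a b := by
  refine ((hw.rpow hs).const_mul (Real.rpow_nonneg hc p)).finitePVar fun u v hu huv hv => ?_
  have h0 := hw.nonneg u v hu huv hv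
  rw [Real.rpow_mul h0, ← Real.mul_rpow hc (Real.rpow_nonneg h0 s)]
  exact Real.rpow_le_rpow (norm_nonneg _) (hxw u v hu huv hv) hp.le

theorem varSup_rpow_le_of_norm_le {c s : ℝ} {w : ℝ → ℝ → ℝ} (hp : 0 < p) (hab : a ≤ b)
    (hw : IsCtrl a b w) (hc : 0 ≤ c) (hs : 1 ≤ s * p)
    (hxw : ∀ u v, a ≤ u → u ≤ v → v ≤ b → ‖x v - x u‖ ≤ c * w u v ^ s) :
    varSup p x a b ^ (1 / p) ≤ c * w a b ^ s := by
  have h0 := hw.nonneg a b le_rfl hab le_rfl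
  have h1 := ((hw.rpow hs).const_mul (Real.rpow_nonneg hc p)).varSup_le (x := x) hp hab
    fun u v hu huv hv => by
      have h0 := hw.nonneg u v hu huv hv
      rw [Real.rpow_mul h0, ← Real.mul_rpow hc (Real.rpow_nonneg h0 s)]
      exact Real.rpow_le_rpow (norm_nonneg _) (hxw u v hu huv hv) hp.le
  have h2 := (isCtrl_varSup hp (FinitePVar.of_norm_le hp hw hc hs hxw)).nonneg a b
    le_rfl hab le_rfl
  rw [Real.rpow_mul h0, ← Real.mul_rpow hc (Real.rpow_nonneg h0 s)] at h1
  have h3 := Real.rpow_le_rpow h2 h1 (one_div_nonneg.2 hp.le)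
  rwa [← Real.rpow_mul (mul_nonneg hc (Real.rpow_nonneg h0 s)), mul_one_div_cancel hp.ne',
    Real.rpow_one] at h3

theorem FinitePVar.of_le {q : ℝ} (hp : 0 < p) (hpq : p ≤ q) (hx : FinitePVar p x a b) :
    FinitePVar q x a b := by
  refine FinitePVar.of_norm_le (c := 1) (s := 1 / p) (hp.trans_le hpq) (isCtrl_varSup hp hx)
    zero_le_one ?_ fun u v hu huv hv => ?_
  · rwa [one_div_mul_eq_div, one_le_div hp]
  · rw [one_mul]
    exact norm_le_varSup hp hx hu huv hv

theorem varSup_rpow_le_varSup_rpow {q : ℝ} (hp : 0 < p) (hpq : p ≤ q) (hab : a ≤ b)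
    (hx : FinitePVar p x a b) : varSup q x a b ^ (1 / q) ≤ varSup p x a b ^ (1 / p) := by
  have := varSup_rpow_le_of_norm_le (c := 1) (s := 1 / p) (x := x) (hp.trans_le hpq) hab
    (isCtrl_varSup hp hx) zero_le_one (by rwa [one_div_mul_eq_div, one_le_div hp])
    fun u v hu huv hv => by
      rw [one_mul]
      exact norm_le_varSup hp hx hu huv hv
  rwa [one_mul] at this

/-- A continuous path of finite `p`-variation has uniformly small `q`-variation on short
intervals, for `q > p`. -/
theorem exists_varSup_le_of_sub_le {q ρ : ℝ} (hp : 0 < p) (hpq : p < q) (hab : a ≤ b)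
    (hc : ContinuousOn x (Icc a b)) (hx : FinitePVar p x a b) (hρ : 0 < ρ) :
    ∃ r, 0 < r ∧ ∀ u v, a ≤ u → u ≤ v → v ≤ b → v - u ≤ r → varSup q x u v ≤ ρ := by
  have hC := isCtrl_varSup hp hx
  set V := varSup p x a b with hV
  have hV0 : 0 ≤ V := hC.nonneg a b le_rfl hab le_rfl
  set e := (ρ / (V + 1)) ^ (1 / (q - p)) with he
  have he0 : 0 < e := by positivity
  have heρ : e ^ (q - p) * V ≤ ρ := by
    rw [he, ← Real.rpow_mul (by positivity), one_div_mul_cancel (sub_pos.2 hpq).ne',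
      Real.rpow_one, div_mul_eq_mul_div, div_le_iff₀ (by positivity)]
    nlinarith
  obtain ⟨r, hr, hru⟩ := Metric.uniformContinuousOn_iff.1
    (isCompact_Icc.uniformContinuousOn_of_continuous hc) e he0
  refine ⟨r / 2, by positivity, fun u v hu huv hv hr2 => ?_⟩
  have h1 := ((hC.restrict hu hv).const_mul (Real.rpow_nonneg he0.le (q - p))).varSup_le
    (x := x) (p := q) (hp.trans hpq) huv fun s t hs hst ht => by
      have h2 : ‖x t - x s‖ ≤ e := by
        rw [← dist_eq_norm]
        refine (hru t ⟨by linarith, by linarith⟩ s ⟨by linarith, by linarith⟩ ?_).le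
        rw [Real.dist_eq, abs_of_nonneg (by linarith)]
        linarith
      rcases (norm_nonneg (x t - x s)).eq_or_lt with h0 | h0
      · rw [← h0, Real.zero_rpow (hp.trans hpq).ne']
        exact mul_nonneg (by positivity) (hC.nonneg _ _ (by linarith) hst (by linarith))
      · have h3 : ‖x t - x s‖ ^ q = ‖x t - x s‖ ^ (q - p) * ‖x t - x s‖ ^ p := by
          rw [← Real.rpow_add h0]
          ring_nf
        rw [h3]
        exact mul_le_mul (Real.rpow_le_rpow h0.le h2 (sub_pos.2 hpq).le)
          (norm_rpow_le_varSup hp hx (by linarith) hst (by linarith)) (by positivity)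
          (by positivity)
  refine h1.trans (le_trans ?_ heρ)
  exact mul_le_mul_of_nonneg_left (hC.mono le_rfl hu huv hv le_rfl) (by positivity)

end Variation

/-! ### Sewing and the Young integral -/

/-- The constant of the discrete sewing estimate with exponent `θ > 1`. -/
def sewConst (θ : ℝ) : ℝ := 2 / (1 - 2 ^ (1 - θ))

theorem two_rpow_one_sub_lt_one {θ : ℝ} (hθ : 1 < θ) : (2 : ℝ) ^ (1 - θ) < 1 :=
  Real.rpow_lt_one_of_one_lt_of_neg one_lt_two (by linarith)

theorem sewConst_pos {θ : ℝ} (hθ : 1 < θ) : 0 < sewConst θ :=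
  div_pos two_pos (sub_pos.2 (two_rpow_one_sub_lt_one hθ))

theorem sewConst_mul {θ : ℝ} (hθ : 1 < θ) : sewConst θ * 2 ^ (1 - θ) + 2 = sewConst θ := by
  have := sub_pos.2 (two_rpow_one_sub_lt_one hθ)
  unfold sewConst
  field_simp
  ring

section Sewing

variable {F : Type*} [NormedAddCommGroup F]

/-- Discrete sewing lemma: an almost additive two-parameter family is close to the sums of its
consecutive values. -/
theorem norm_sum_sub_le_of_almost_additive {Ξ : ℕ → ℕ → F} {w : ℕ → ℕ → ℝ} {c θ : ℝ}
    (hθ : 1 < θ) (hc : 0 ≤ c) (hw0 : ∀ i j, i ≤ j → 0 ≤ w i j)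
    (hw : ∀ i j k, i ≤ j → j ≤ k → w i j + w j k ≤ w i k)
    (hΞ : ∀ i j k, i ≤ j → j ≤ k → ‖Ξ i k - Ξ i j - Ξ j k‖ ≤ c * w i k ^ θ) (n : ℕ) :
    ∀ i, ‖∑ l ∈ Finset.range n, Ξ (i + l) (i + l + 1) - Ξ i (i + n)‖ ≤
      c * sewConst θ * w i (i + n) ^ θ := by
  have hw00 : ∀ i, w i i = 0 := fun i =>
    le_antisymm (by linarith [hw i i i le_rfl le_rfl]) (hw0 i i le_rfl)
  have hθ0 : 0 < θ := by linarith
  have hC := sewConst_pos hθ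
  induction n using Nat.strong_induction_on with
  | _ n ih =>
    intro i
    rcases Nat.eq_zero_or_pos n with rfl | hn
    · have := hΞ i i i le_rfl le_rfl
      simp only [hw00, Real.zero_rpow hθ0.ne', mul_zero, sub_self, zero_sub, norm_neg] at this
      simpa [hw00, Real.zero_rpow hθ0.ne'] using this
    set W := w i (i + n) with hW
    have hW0 : 0 ≤ W := hw0 _ _ (by omega)
    let P : ℕ → Prop := fun k => w i (i + k) ≤ W / 2
    classical
    set k := Nat.findGreatest P (n - 1) with hk
    have hkn : k ≤ n - 1 := Nat.findGreatest_le _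
    have hPk : w i (i + k) ≤ W / 2 :=
      Nat.findGreatest_spec (P := P) (Nat.zero_le _) (by simp [P, hw00]; linarith)
    have hright : w (i + k + 1) (i + n) ≤ W / 2 := by
      rcases hkn.eq_or_lt with h | h
      · have : i + k + 1 = i + n := by omega
        rw [this, hw00]
        linarith
      · have h1 : ¬ P (k + 1) := Nat.findGreatest_is_greatest (Nat.lt_succ_self k) (by omega)
        have h2 := hw i (i + (k + 1)) (i + n) (by omega) (by omega)
        simp only [P, not_le] at h1
        have h3 : i + k + 1 = i + (k + 1) := by omega
        rw [h3]
        linarith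
    clear_value k
    clear hk
    obtain ⟨m, rfl⟩ : ∃ m, n = k + 1 + m := ⟨n - (k + 1), by omega⟩
    have e1 := ih k (by omega) i
    have e2 := ih m (by omega) (i + k + 1)
    have e3 : i + k + 1 + m = i + (k + 1 + m) := by omega
    rw [e3] at e2
    have d1 := hΞ i (i + k) (i + (k + 1 + m)) (by omega) (by omega)
    have d2 := hΞ (i + k) (i + k + 1) (i + (k + 1 + m)) (by omega) (by omega)
    rw [← hW] at d1
    have hmid : w (i + k) (i + (k + 1 + m)) ≤ W := by
      have := hw i (i + k) (i + (k + 1 + m)) (by omega) (by omega)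
      have := hw0 i (i + k) (by omega)
      linarith
    have b1 : w i (i + k) ^ θ ≤ (W / 2) ^ θ :=
      Real.rpow_le_rpow (hw0 _ _ (by omega)) hPk hθ0.le
    have b2 : w (i + k + 1) (i + (k + 1 + m)) ^ θ ≤ (W / 2) ^ θ :=
      Real.rpow_le_rpow (hw0 _ _ (by omega)) hright hθ0.le
    have b3 : w (i + k) (i + (k + 1 + m)) ^ θ ≤ W ^ θ :=
      Real.rpow_le_rpow (hw0 _ _ (by omega)) hmid hθ0.le
    have hhalf : 2 * (W / 2) ^ θ = 2 ^ (1 - θ) * W ^ θ := by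
      rw [Real.div_rpow hW0 zero_le_two, Real.rpow_sub two_pos, Real.rpow_one]
      ring
    have hsum : ∑ l ∈ Finset.range (k + 1 + m), Ξ (i + l) (i + l + 1) =
        ∑ l ∈ Finset.range k, Ξ (i + l) (i + l + 1) + Ξ (i + k) (i + k + 1) +
          ∑ l ∈ Finset.range m, Ξ (i + k + 1 + l) (i + k + 1 + l + 1) := by
      rw [Finset.sum_range_add, Finset.sum_range_succ]
      simp only [add_assoc]
    rw [hsum]
    set S1 := ∑ l ∈ Finset.range k, Ξ (i + l) (i + l + 1)
    set S2 := ∑ l ∈ Finset.range m, Ξ (i + k + 1 + l) (i + k + 1 + l + 1)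
    have hdec : S1 + Ξ (i + k) (i + k + 1) + S2 - Ξ i (i + (k + 1 + m)) =
        (S1 - Ξ i (i + k)) + (S2 - Ξ (i + k + 1) (i + (k + 1 + m))) -
        (Ξ i (i + (k + 1 + m)) - Ξ i (i + k) - Ξ (i + k) (i + (k + 1 + m))) -
        (Ξ (i + k) (i + (k + 1 + m)) - Ξ (i + k) (i + k + 1) -
          Ξ (i + k + 1) (i + (k + 1 + m))) := by abel
    rw [hdec]
    have hcC : 0 ≤ c * sewConst θ := mul_nonneg hc hC.le
    have f1 := mul_le_mul_of_nonneg_left b1 hcC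
    have f2 := mul_le_mul_of_nonneg_left b2 hcC
    have f3 := mul_le_mul_of_nonneg_left b3 hc
    calc _ ≤ _ := (norm_sub_le _ _).trans (add_le_add_left ((norm_sub_le _ _).trans
          (add_le_add_left (norm_add_le _ _) _)) _)
      _ ≤ c * sewConst θ * (W / 2) ^ θ + c * sewConst θ * (W / 2) ^ θ + c * W ^ θ +
          c * W ^ θ := by linarith
      _ = c * (sewConst θ * (2 * (W / 2) ^ θ) + 2 * W ^ θ) := by ring
      _ = c * ((sewConst θ * 2 ^ (1 - θ) + 2) * W ^ θ) := by rw [hhalf]; ring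
      _ = c * sewConst θ * W ^ θ := by rw [sewConst_mul hθ]; ring

/-- A superadditive control is uniformly small on short intervals. -/
def UnifSmall (a b : ℝ) (w : ℝ → ℝ → ℝ) : Prop :=
  ∀ ρ : ℝ, 0 < ρ → ∃ r, 0 < r ∧ ∀ u v, a ≤ u → u ≤ v → v ≤ b → v - u ≤ r → w u v ≤ ρ

theorem IsCtrl.sum_rpow_le {a b θ ρ : ℝ} {w : ℝ → ℝ → ℝ} (hw : IsCtrl a b w) (hθ : 1 < θ)
    {t : ℕ → ℝ} (ht : Monotone t) (h0 : a ≤ t 0) (n : ℕ) (hn : t n ≤ b)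
    (hρ : ∀ i < n, w (t i) (t (i + 1)) ≤ ρ) :
    ∑ i ∈ Finset.range n, w (t i) (t (i + 1)) ^ θ ≤ ρ ^ (θ - 1) * w (t 0) (t n) := by
  rcases Nat.eq_zero_or_pos n with rfl | hn0
  · have h1 : w (t 0) (t 0) = 0 := le_antisymm
      (by linarith [hw.superadd (t 0) (t 0) (t 0) h0 le_rfl le_rfl hn])
      (hw.nonneg _ _ h0 le_rfl hn)
    simp [h1]
  have hnn : ∀ i < n, 0 ≤ w (t i) (t (i + 1)) := fun i hi =>
    hw.nonneg _ _ (h0.trans (ht i.zero_le)) (ht i.le_succ) ((ht hi).trans hn)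
  have hρ0 : 0 ≤ ρ := (hnn 0 hn0).trans (hρ 0 hn0)
  refine le_trans ?_ (mul_le_mul_of_nonneg_left (hw.sum_le ht h0 n hn)
    (Real.rpow_nonneg hρ0 _))
  rw [Finset.mul_sum]
  refine Finset.sum_le_sum fun i hi => ?_
  have hi := Finset.mem_range.1 hi
  rcases (hnn i hi).eq_or_lt with h | h
  · rw [← h, Real.zero_rpow (by linarith), mul_zero]
  · calc w (t i) (t (i + 1)) ^ θ = w (t i) (t (i + 1)) ^ (θ - 1) * w (t i) (t (i + 1)) := by
          rw [← Real.rpow_add_one h.ne']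
          ring_nf
      _ ≤ _ := mul_le_mul_of_nonneg_right
          (Real.rpow_le_rpow h.le (hρ i hi) (by linarith)) h.le

end Sewing

section Young

variable {E F : Type*} [NormedAddCommGroup E] [NormedSpace ℝ E]
  [NormedAddCommGroup F] [NormedSpace ℝ F]

theorem TaggedPartition.sub_le_mesh {a b : ℝ} (P : TaggedPartition a b) (i : Fin P.n) :
    P.t i.succ - P.t i.castSucc ≤ P.mesh :=
  le_ciSup (f := fun i : Fin P.n => P.t i.succ - P.t i.castSucc)
    (Set.finite_range _).bddAbove i

theorem TaggedPartition.exists_mesh_lt {a b r : ℝ} (hab : a ≤ b) (hr : 0 < r) :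
    ∃ P : TaggedPartition a b, P.mesh < r := by
  rcases hab.eq_or_lt with rfl | hab
  · refine ⟨⟨0, fun _ => a, fun _ => a, Subsingleton.strictMono (α := Fin 1) _, rfl, rfl,
      fun i => i.elim0⟩, ?_⟩
    unfold TaggedPartition.mesh
    simpa using hr
  obtain ⟨N, hN⟩ := exists_nat_gt ((b - a) / r)
  have hba := sub_pos.2 hab
  have hN0 : (0 : ℝ) < N := (div_pos hba hr).trans hN
  have hstep : ∀ i : Fin N, a + ((i.succ : ℕ) : ℝ) * ((b - a) / N) -
      (a + ((i.castSucc : ℕ) : ℝ) * ((b - a) / N)) = (b - a) / N := by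
    intro i
    push_cast [Fin.val_succ, Fin.val_castSucc]
    ring
  have hpos : 0 < (b - a) / N := div_pos hba hN0
  refine ⟨⟨N, fun i => a + (i : ℕ) * ((b - a) / N),
    fun i => a + ((i.castSucc : ℕ) : ℝ) * ((b - a) / N), ?_, ?_, ?_, ?_⟩, ?_⟩
  · rw [Fin.strictMono_iff_lt_succ]
    intro i
    have := hstep i
    linarith
  · simp
  · simp only [Fin.val_last]
    field_simp
    ring
  · intro i
    have := hstep i
    exact ⟨le_rfl, by linarith⟩
  · have : Nonempty (Fin N) := ⟨⟨0, by exact_mod_cast hN0⟩⟩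
    unfold TaggedPartition.mesh
    refine (ciSup_le fun i => (hstep i).le).trans_lt ?_
    rw [div_lt_iff₀ hN0]
    rw [div_lt_iff₀ hr] at hN
    linarith

theorem IsYoungIntegral.unique {x : ℝ → E →L[ℝ] F} {ω : ℝ → E} {a b : ℝ} {v v' : F}
    (hab : a ≤ b) (h : IsYoungIntegral x ω a b v) (h' : IsYoungIntegral x ω a b v') :
    v = v' := by
  refine eq_of_forall_dist_le fun ε hε => ?_
  obtain ⟨r, hr, h1⟩ := h (ε / 2) (half_pos hε)
  obtain ⟨r', hr', h2⟩ := h' (ε / 2) (half_pos hε)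
  obtain ⟨P, hP⟩ := TaggedPartition.exists_mesh_lt hab (lt_min hr hr')
  have e1 := h1 P (hP.trans_le (min_le_left _ _))
  have e2 := h2 P (hP.trans_le (min_le_right _ _))
  rw [dist_eq_norm]
  have : v - v' = (RSSum x ω P - v') - (RSSum x ω P - v) := by abel
  rw [this]
  exact (norm_sub_le _ _).trans (by linarith)

theorem IsYoungIntegral.youngIntegral_eq {x : ℝ → E →L[ℝ] F} {ω : ℝ → E} {a b : ℝ} {v : F}
    (hab : a ≤ b) (h : IsYoungIntegral x ω a b v) : youngIntegral x ω a b = v := by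
  have hex : ∃ v, IsYoungIntegral x ω a b v := ⟨v, h⟩
  unfold youngIntegral
  rw [dif_pos hex]
  exact hex.choose_spec.unique hab h

theorem IsYoungIntegral.add {x y : ℝ → E →L[ℝ] F} {ω σ : ℝ → E} {a b : ℝ} {v v' : F}
    (h : IsYoungIntegral x ω a b v) (h' : IsYoungIntegral y σ a b v') :
    ∀ ε : ℝ, 0 < ε → ∃ r : ℝ, 0 < r ∧
      ∀ P : TaggedPartition a b, P.mesh < r → ‖RSSum x ω P + RSSum y σ P - (v + v')‖ < ε := by
  intro ε hε
  obtain ⟨r, hr, h1⟩ := h (ε / 2) (half_pos hε)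
  obtain ⟨r', hr', h2⟩ := h' (ε / 2) (half_pos hε)
  refine ⟨min r r', lt_min hr hr', fun P hP => ?_⟩
  have e1 := h1 P (hP.trans_le (min_le_left _ _))
  have e2 := h2 P (hP.trans_le (min_le_right _ _))
  rw [add_sub_add_comm]
  exact (norm_add_le _ _).trans_lt (by linarith)

/-- The difference of two Young integrals splits into the integral of the difference of the
integrands and the integral against the difference of the drivers. -/
theorem IsYoungIntegral.sub_eq {x y : ℝ → E →L[ℝ] F} {ω σ : ℝ → E} {a b : ℝ}
    {v₁ v₂ v₃ v₄ : F} (hab : a ≤ b) (h₁ : IsYoungIntegral y σ a b v₁)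
    (h₂ : IsYoungIntegral x ω a b v₂) (h₃ : IsYoungIntegral (fun u => y u - x u) σ a b v₃)
    (h₄ : IsYoungIntegral x (fun u => σ u - ω u) a b v₄) : v₁ - v₂ = v₃ + v₄ := by
  have hsum : ∀ P : TaggedPartition a b, RSSum (fun u => y u - x u) σ P +
      RSSum x (fun u => σ u - ω u) P + RSSum x ω P = RSSum y σ P := by
    intro P
    simp only [RSSum, ← Finset.sum_add_distrib]
    refine Finset.sum_congr rfl fun i _ => ?_
    simp only [map_sub, sub_apply]
    abel
  have h : IsYoungIntegral y σ a b (v₃ + v₄ + v₂) := by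
    intro ε hε
    obtain ⟨r, hr, e1⟩ := h₃.add h₄ (ε / 2) (half_pos hε)
    obtain ⟨r', hr', e2⟩ := h₂ (ε / 2) (half_pos hε)
    refine ⟨min r r', lt_min hr hr', fun P hP => ?_⟩
    have e1 := e1 P (hP.trans_le (min_le_left _ _))
    have e2 := e2 P (hP.trans_le (min_le_right _ _))
    rw [← hsum P, add_sub_add_comm]
    exact (norm_add_le _ _).trans_lt (by linarith)
  rw [h₁.unique hab h, add_sub_cancel_right]

variable {a b c θ : ℝ} {w : ℝ → ℝ → ℝ} {G : ℝ → E →L[ℝ] F} {ω : ℝ → E}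

/-- An indefinite integral with a local error of order `w ^ θ` is the Young integral. -/
theorem isYoungIntegral_of_norm_sub_le {J : ℝ → F} {K : ℝ} (hθ : 1 < θ)
    (hw : IsCtrl a b w) (hws : UnifSmall a b w) (hc : 0 ≤ c) (hK : 0 ≤ K)
    (hG : ∀ u v, a ≤ u → u ≤ v → v ≤ b → ∀ s ∈ Icc u v,
      ‖G s - G u‖ * ‖ω v - ω u‖ ≤ c * w u v ^ θ)
    (hJ : ∀ u v, a ≤ u → u ≤ v → v ≤ b →
      ‖J v - J u - G u (ω v - ω u)‖ ≤ K * w u v ^ θ) {u v : ℝ}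
    (hu : a ≤ u) (huv : u ≤ v) (hv : v ≤ b) : IsYoungIntegral G ω u v (J v - J u) := by
  intro ε hε
  have hW0 := hw.nonneg u v hu huv hv
  set A := (c + K) * w u v with hA
  have hA0 : 0 ≤ A := mul_nonneg (add_nonneg hc hK) hW0
  have hθ1 : 0 < θ - 1 := sub_pos.2 hθ
  set ρ := (ε / 2 / (A + 1)) ^ (1 / (θ - 1)) with hρ
  have hρ0 : 0 < ρ := by positivity
  have hρA : ρ ^ (θ - 1) * A < ε := by
    rw [hρ, ← Real.rpow_mul (by positivity), one_div_mul_cancel hθ1.ne', Real.rpow_one,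
      div_mul_eq_mul_div, div_lt_iff₀ (by positivity)]
    nlinarith
  obtain ⟨r, hr, hru⟩ := hws ρ hρ0
  refine ⟨r, hr, fun P hP => ?_⟩
  obtain ⟨τ, hτ, hτ0, hτn, hτi⟩ := exists_seq_of_strictMono P.mono
  have h0 : τ 0 = u := hτ0.trans P.first
  have hn : τ P.n = v := hτn.trans P.last
  have hmem : ∀ i < P.n, a ≤ τ i ∧ τ i ≤ τ (i + 1) ∧ τ (i + 1) ≤ b := fun i hi =>
    ⟨hu.trans (h0 ▸ hτ i.zero_le), hτ i.le_succ, (hτ hi).trans (hn.trans_le hv)⟩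
  have htel : J v - J u = ∑ i : Fin P.n, (J (P.t i.succ) - J (P.t i.castSucc)) := by
    have h1 := Finset.sum_range_sub (fun i => J (τ i)) P.n
    rw [← Fin.sum_univ_eq_sum_range (fun i => J (τ (i + 1)) - J (τ i)), h0, hn] at h1
    rw [← h1]
    exact Finset.sum_congr rfl fun i _ => by rw [(hτi i).1, (hτi i).2]
  have hterm : ∀ i : Fin P.n, ‖G (P.tag i) (ω (P.t i.succ) - ω (P.t i.castSucc)) -
      (J (P.t i.succ) - J (P.t i.castSucc))‖ ≤ (c + K) * w (τ i) (τ (i + 1)) ^ θ := by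
    intro i
    obtain ⟨m1, m2, m3⟩ := hmem i i.2
    have htag := P.tag_mem i
    rw [← (hτi i).1, ← (hτi i).2] at htag ⊢
    have e1 := hJ _ _ m1 m2 m3
    have e2 := hG _ _ m1 m2 m3 _ htag
    have e3 := (G (P.tag i) - G (τ i)).le_opNorm (ω (τ (i + 1)) - ω (τ i))
    have : G (P.tag i) (ω (τ (i + 1)) - ω (τ i)) - (J (τ (i + 1)) - J (τ i)) =
        (G (P.tag i) - G (τ i)) (ω (τ (i + 1)) - ω (τ i)) -
        (J (τ (i + 1)) - J (τ i) - G (τ i) (ω (τ (i + 1)) - ω (τ i))) := by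
      rw [sub_apply]
      abel
    rw [this]
    refine (norm_sub_le _ _).trans ?_
    linarith
  have hsmall := hw.sum_rpow_le hθ hτ (hu.trans_eq h0.symm) P.n (hn.trans_le hv) (ρ := ρ)
    fun i hi => by
      obtain ⟨m1, m2, m3⟩ := hmem i hi
      refine hru _ _ m1 m2 m3 ?_
      have := P.sub_le_mesh ⟨i, hi⟩
      rw [← (hτi ⟨i, hi⟩).1, ← (hτi ⟨i, hi⟩).2] at this
      exact this.trans hP.le
  rw [htel, RSSum, ← Finset.sum_sub_distrib]
  calc _ ≤ _ := norm_sum_le_of_le _ fun i _ => hterm i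
    _ = (c + K) * ∑ i ∈ Finset.range P.n, w (τ i) (τ (i + 1)) ^ θ := by
      rw [Finset.mul_sum, Fin.sum_univ_eq_sum_range (fun i => (c + K) * w (τ i) (τ (i + 1)) ^ θ)]
    _ ≤ (c + K) * (ρ ^ (θ - 1) * w (τ 0) (τ P.n)) :=
      mul_le_mul_of_nonneg_left hsmall (add_nonneg hc hK)
    _ = ρ ^ (θ - 1) * A := by rw [h0, hn, hA]; ring
    _ < ε := hρA

theorem max_min_mem_Icc {u v t t' : ℝ} (htt : t ≤ t') (h1 : max u (min v t) ≠ t)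
    (h2 : max u (min v t) ≠ max u (min v t')) :
    max u (min v t) ∈ Icc t t' ∧ max u (min v t') ∈ Icc t t' := by
  simp only [mem_Icc]
  grind

/-- The left-point approximation, along the grid `t`, of the indefinite integral of `G`
against `ω`. -/
def gridIntegral (G : ℝ → E →L[ℝ] F) (ω : ℝ → E) (t : ℕ → ℝ) (n : ℕ) (u : ℝ) : F :=
  ∑ i ∈ Finset.range n, G (t i) (ω (min u (t (i + 1))) - ω (min u (t i)))

theorem gridIntegral_sub {t : ℕ → ℝ} {u v : ℝ} (huv : u ≤ v) (n : ℕ) :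
    gridIntegral G ω t n v - gridIntegral G ω t n u = ∑ i ∈ Finset.range n,
      G (t i) (ω (max u (min v (t (i + 1)))) - ω (max u (min v (t i)))) := by
  have key : ∀ s, ω (min v s) - ω (min u s) = ω (max u (min v s)) - ω u := by
    intro s
    rcases le_total s u with h | h
    · rw [min_eq_right h, min_eq_right (h.trans huv), max_eq_left h, sub_self, sub_self]
    · rw [min_eq_left h, max_eq_right (le_min huv h)]
  rw [gridIntegral, gridIntegral, ← Finset.sum_sub_distrib]
  refine Finset.sum_congr rfl fun i _ => ?_
  rw [← map_sub, sub_sub_sub_comm, key, key, sub_sub_sub_cancel_right]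

theorem norm_gridIntegral_sub_le {t : ℕ → ℝ} {n : ℕ} (hθ : 1 < θ)
    (hw : IsCtrl a b w) (hc : 0 ≤ c)
    (hG : ∀ u v, a ≤ u → u ≤ v → v ≤ b → ∀ s ∈ Icc u v, ∀ s' ∈ Icc u v, ∀ r ∈ Icc u v,
      ∀ r' ∈ Icc u v, ‖G s - G s'‖ * ‖ω r - ω r'‖ ≤ c * w u v ^ θ)
    (ht : Monotone t) (h0 : t 0 = a) (hn : t n = b) {u v : ℝ} (hu : a ≤ u) (huv : u ≤ v)
    (hv : v ≤ b) :
    ‖gridIntegral G ω t n v - gridIntegral G ω t n u - G u (ω v - ω u)‖ ≤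
      c * sewConst θ * w u v ^ θ + c * ∑ i ∈ Finset.range n, w (t i) (t (i + 1)) ^ θ := by
  rw [gridIntegral_sub huv]
  set τ : ℕ → ℝ := fun i => max u (min v (t i)) with hτ
  have hτm : Monotone τ := fun i j hij => max_le_max le_rfl (min_le_min le_rfl (ht hij))
  have hτ0 : τ 0 = u := by simp [hτ, h0, hu]
  have hτn : τ n = v := by simp [hτ, hn, hv, huv]
  have hτu : ∀ i, u ≤ τ i := fun i => le_max_left _ _
  have hτv : ∀ i, τ i ≤ v := fun i => max_le huv (min_le_left _ _)
  have hsew := norm_sum_sub_le_of_almost_additive (Ξ := fun i j => G (τ i) (ω (τ j) - ω (τ i)))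
    (w := fun i j => w (τ i) (τ j)) hθ hc
    (fun i j hij => hw.nonneg _ _ (hu.trans (hτu i)) (hτm hij) ((hτv j).trans hv))
    (fun i j k hij hjk => hw.superadd _ _ _ (hu.trans (hτu i)) (hτm hij) (hτm hjk)
      ((hτv k).trans hv))
    (fun i j k hij hjk => by
      have e : G (τ i) (ω (τ k) - ω (τ i)) - G (τ i) (ω (τ j) - ω (τ i)) -
          G (τ j) (ω (τ k) - ω (τ j)) = (G (τ i) - G (τ j)) (ω (τ k) - ω (τ j)) := by
        simp only [sub_apply, map_sub]
        abel
      rw [e]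
      have hik := hτm (hij.trans hjk)
      exact ((G (τ i) - G (τ j)).le_opNorm _).trans
        (hG _ _ (hu.trans (hτu i)) hik ((hτv k).trans hv) _
          ⟨le_rfl, hik⟩ _ ⟨hτm hij, hτm hjk⟩ _ ⟨hik, le_rfl⟩ _ ⟨hτm hij, hτm hjk⟩)) n 0
  simp only [zero_add, hτ0, hτn] at hsew
  have herr : ‖∑ i ∈ Finset.range n, (G (t i) - G (τ i)) (ω (τ (i + 1)) - ω (τ i))‖ ≤
      c * ∑ i ∈ Finset.range n, w (t i) (t (i + 1)) ^ θ := by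
    rw [Finset.mul_sum]
    refine norm_sum_le_of_le _ fun i hi => ?_
    have hai : a ≤ t i := h0 ▸ ht i.zero_le
    have hib : t (i + 1) ≤ b := hn ▸ ht (Finset.mem_range.1 hi)
    have hii := ht i.le_succ
    have hnn : 0 ≤ c * w (t i) (t (i + 1)) ^ θ :=
      mul_nonneg hc (Real.rpow_nonneg (hw.nonneg _ _ hai hii hib) _)
    by_cases h1 : τ i = t i
    · simpa [h1] using hnn
    by_cases h2 : τ i = τ (i + 1)
    · simpa [h2] using hnn
    obtain ⟨m1, m2⟩ := max_min_mem_Icc hii h1 h2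
    exact ((G (t i) - G (τ i)).le_opNorm _).trans
      (hG _ _ hai hii hib _ ⟨le_rfl, hii⟩ _ m1 _ m2 _ m1)
  have hdec : ∑ i ∈ Finset.range n, G (t i) (ω (τ (i + 1)) - ω (τ i)) - G u (ω v - ω u) =
      (∑ i ∈ Finset.range n, G (τ i) (ω (τ (i + 1)) - ω (τ i)) - G u (ω v - ω u)) +
      ∑ i ∈ Finset.range n, (G (t i) - G (τ i)) (ω (τ (i + 1)) - ω (τ i)) := by
    simp only [sub_apply, Finset.sum_sub_distrib]
    abel
  rw [hdec]
  exact (norm_add_le _ _).trans (add_le_add hsew herr)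

/-- The uniform grid of `[a, b]` with `n + 1` steps. -/
def uniformGrid (a b : ℝ) (n i : ℕ) : ℝ := a + i * ((b - a) / (n + 1))

theorem uniformGrid_monotone (hab : a ≤ b) (n : ℕ) : Monotone (uniformGrid a b n) := by
  intro i j hij
  have h1 : (i : ℝ) ≤ j := by exact_mod_cast hij
  have h2 : 0 ≤ (b - a) / (n + 1) := div_nonneg (sub_nonneg.2 hab) (by positivity)
  have := mul_le_mul_of_nonneg_right h1 h2
  unfold uniformGrid
  linarith

theorem uniformGrid_zero (n : ℕ) : uniformGrid a b n 0 = a := by simp [uniformGrid]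

theorem uniformGrid_last (n : ℕ) : uniformGrid a b n (n + 1) = b := by
  unfold uniformGrid
  push_cast
  field_simp
  ring

theorem tendsto_sum_uniformGrid (hab : a ≤ b) (hθ : 1 < θ) (hw : IsCtrl a b w)
    (hws : UnifSmall a b w) : Filter.Tendsto (fun n => ∑ i ∈ Finset.range (n + 1),
      w (uniformGrid a b n i) (uniformGrid a b n (i + 1)) ^ θ) Filter.atTop (nhds 0) := by
  rw [Metric.tendsto_atTop]
  intro ε hε
  have hA0 := hw.nonneg a b le_rfl hab le_rfl
  set A := w a b with hA
  have hθ1 : 0 < θ - 1 := sub_pos.2 hθ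
  set ρ := (ε / 2 / (A + 1)) ^ (1 / (θ - 1)) with hρ
  have hρ0 : 0 < ρ := by positivity
  have hρA : ρ ^ (θ - 1) * A < ε := by
    rw [hρ, ← Real.rpow_mul (by positivity), one_div_mul_cancel hθ1.ne', Real.rpow_one,
      div_mul_eq_mul_div, div_lt_iff₀ (by positivity)]
    nlinarith
  obtain ⟨r, hr, hru⟩ := hws ρ hρ0
  obtain ⟨N, hN⟩ := exists_nat_gt ((b - a) / r)
  refine ⟨N, fun n hn => ?_⟩
  have hm := uniformGrid_monotone hab n
  have h0 := uniformGrid_zero (a := a) (b := b) n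
  have hl := uniformGrid_last (a := a) (b := b) n
  have hbd : ∀ i < n + 1, a ≤ uniformGrid a b n i ∧
      uniformGrid a b n i ≤ uniformGrid a b n (i + 1) ∧ uniformGrid a b n (i + 1) ≤ b :=
    fun i hi => ⟨h0.symm.le.trans (hm i.zero_le), hm i.le_succ, (hm hi).trans hl.le⟩
  have hs := hw.sum_rpow_le hθ hm h0.symm.le (n + 1) hl.le (ρ := ρ) fun i hi => by
    obtain ⟨m1, m2, m3⟩ := hbd i hi
    refine hru _ _ m1 m2 m3 ?_
    have hnN : (N : ℝ) ≤ n := by exact_mod_cast hn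
    have : uniformGrid a b n (i + 1) - uniformGrid a b n i = (b - a) / (n + 1) := by
      unfold uniformGrid
      push_cast
      ring
    rw [this, div_le_iff₀ (by positivity)]
    rw [div_lt_iff₀ hr] at hN
    nlinarith
  rw [h0, hl] at hs
  rw [Real.dist_eq, sub_zero, abs_of_nonneg]
  · exact hs.trans_lt hρA
  · refine Finset.sum_nonneg fun i hi => ?_
    obtain ⟨m1, m2, m3⟩ := hbd i (Finset.mem_range.1 hi)
    exact Real.rpow_nonneg (hw.nonneg _ _ m1 m2 m3) _

/-- Existence of the indefinite Young integral, with the Young–Loève estimate. -/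
theorem exists_indefinite_integral [ProperSpace F] (hab : a ≤ b) (hθ : 1 < θ)
    (hw : IsCtrl a b w) (hws : UnifSmall a b w) (hc : 0 ≤ c)
    (hG : ∀ u v, a ≤ u → u ≤ v → v ≤ b → ∀ s ∈ Icc u v, ∀ s' ∈ Icc u v, ∀ r ∈ Icc u v,
      ∀ r' ∈ Icc u v, ‖G s - G s'‖ * ‖ω r - ω r'‖ ≤ c * w u v ^ θ) :
    ∃ J : ℝ → F, ∀ u v, a ≤ u → u ≤ v → v ≤ b →
      ‖J v - J u - G u (ω v - ω u)‖ ≤ c * sewConst θ * w u v ^ θ ∧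
      IsYoungIntegral G ω u v (J v - J u) := by
  have hC := sewConst_pos hθ
  set e : ℕ → ℝ := fun n => ∑ i ∈ Finset.range (n + 1),
      w (uniformGrid a b n i) (uniformGrid a b n (i + 1)) ^ θ with he
  have hlim : Filter.Tendsto e Filter.atTop (nhds 0) := tendsto_sum_uniformGrid hab hθ hw hws
  set I : ℕ → ℝ → F := fun n => gridIntegral G ω (uniformGrid a b n) (n + 1) with hI
  have hest : ∀ n u v, a ≤ u → u ≤ v → v ≤ b →
      ‖I n v - I n u - G u (ω v - ω u)‖ ≤ c * sewConst θ * w u v ^ θ + c * e n :=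
    fun n u v hu huv hv => norm_gridIntegral_sub_le hθ hw hc hG (uniformGrid_monotone hab n)
      (uniformGrid_zero n) (uniformGrid_last n) hu huv hv
  obtain ⟨B, hB⟩ := hlim.bddAbove_range
  have hBe : ∀ n, e n ≤ B := fun n => hB ⟨n, rfl⟩
  have hI0 : ∀ n, I n a = 0 := by
    intro n
    refine Finset.sum_eq_zero fun i _ => ?_
    have h1 : ∀ i, a ≤ uniformGrid a b n i := fun i =>
      (uniformGrid_zero (a := a) (b := b) n).symm.le.trans (uniformGrid_monotone hab n i.zero_le)
    rw [min_eq_left (h1 _), min_eq_left (h1 _), sub_self, map_zero]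
  have hlimit : ∀ u : ℝ, ∃ y : F, a ≤ u → u ≤ b →
      Filter.Tendsto (fun n => I n u) (Filter.hyperfilter ℕ : Filter ℕ) (nhds y) := by
    intro u
    by_cases hu : a ≤ u ∧ u ≤ b
    · set R := c * sewConst θ * w a u ^ θ + c * B + ‖G a (ω u - ω a)‖ with hR
      have hmem : ∀ n, I n u ∈ Metric.closedBall (0 : F) R := by
        intro n
        have h1 := hest n a u le_rfl hu.1 hu.2
        have h2 := mul_le_mul_of_nonneg_left (hBe n) hc
        rw [hI0, sub_zero] at h1
        have h3 := norm_add_le (I n u - G a (ω u - ω a)) (G a (ω u - ω a))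
        rw [sub_add_cancel] at h3
        rw [mem_closedBall_zero_iff]
        linarith
      obtain ⟨y, -, hy⟩ := (isCompact_closedBall (0 : F) R).ultrafilter_le_nhds
        ((Filter.hyperfilter ℕ).map fun n => I n u)
        (Filter.le_principal_iff.2 (Filter.mem_map.2 (Filter.univ_mem' hmem)))
      exact ⟨y, fun _ _ => hy⟩
    · exact ⟨0, fun h1 h2 => absurd ⟨h1, h2⟩ hu⟩
  choose J hJ using hlimit
  have hJest : ∀ u v, a ≤ u → u ≤ v → v ≤ b →
      ‖J v - J u - G u (ω v - ω u)‖ ≤ c * sewConst θ * w u v ^ θ := by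
    intro u v hu huv hv
    have h1 := hJ u hu (huv.trans hv)
    have h2 := hJ v (hu.trans huv) hv
    have h3 : Filter.Tendsto (fun n => c * sewConst θ * w u v ^ θ + c * e n)
        (Filter.hyperfilter ℕ : Filter ℕ) (nhds (c * sewConst θ * w u v ^ θ + c * 0)) :=
      ((hlim.mono_left Nat.hyperfilter_le_atTop).const_mul c).const_add _
    have h4 := le_of_tendsto_of_tendsto ((h2.sub h1).sub_const (G u (ω v - ω u))).norm h3
      (Filter.Eventually.of_forall fun n => hest n u v hu huv hv)
    simpa using h4
  refine ⟨J, fun u v hu huv hv => ⟨hJest u v hu huv hv, ?_⟩⟩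
  exact isYoungIntegral_of_norm_sub_le hθ hw hws hc (mul_nonneg hc hC.le)
    (fun u v hu huv hv s hs => hG u v hu huv hv s hs u ⟨le_rfl, huv⟩ v ⟨huv, le_rfl⟩ u
      ⟨le_rfl, huv⟩) hJest hu huv hv

/-- The Young–Loève estimate for paths controlled by `w₁` and `w₂`. -/
theorem exists_young_integral [ProperSpace F] {p q c₁ c₂ : ℝ} {w₁ w₂ : ℝ → ℝ → ℝ}
    (hab : a ≤ b) (hp : 0 < p) (hq : 0 < q) (hpq : 1 < 1 / p + 1 / q)
    (hw₁ : IsCtrl a b w₁) (hw₂ : IsCtrl a b w₂) (hws : UnifSmall a b w₂) (hc₁ : 0 ≤ c₁)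
    (hc₂ : 0 ≤ c₂)
    (hG : ∀ u v, a ≤ u → u ≤ v → v ≤ b → ‖G v - G u‖ ≤ c₁ * w₁ u v ^ (1 / q))
    (hω : ∀ u v, a ≤ u → u ≤ v → v ≤ b → ‖ω v - ω u‖ ≤ c₂ * w₂ u v ^ (1 / p)) :
    ∃ J : ℝ → F, ∀ u v, a ≤ u → u ≤ v → v ≤ b →
      ‖J v - J u - G u (ω v - ω u)‖ ≤ sewConst (1 / p + 1 / q) *
        (c₁ * w₁ u v ^ (1 / q)) * (c₂ * w₂ u v ^ (1 / p)) ∧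
      IsYoungIntegral G ω u v (J v - J u) := by
  set θ := 1 / p + 1 / q with hθ
  have hθ0 : 0 < θ := by linarith
  have hq' : 0 < 1 / q := one_div_pos.2 hq
  have hp' : 0 < 1 / p := one_div_pos.2 hp
  set w : ℝ → ℝ → ℝ := fun u v => w₁ u v ^ (1 / q / θ) * w₂ u v ^ (1 / p / θ) with hwdef
  have hw : IsCtrl a b w := hw₁.rpow_mul_rpow hw₂ (div_pos hq' hθ0) (div_pos hp' hθ0)
    (by rw [← add_div, add_comm, ← hθ, div_self hθ0.ne'])
  have hwθ : ∀ u v, a ≤ u → u ≤ v → v ≤ b →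
      w u v ^ θ = w₁ u v ^ (1 / q) * w₂ u v ^ (1 / p) := by
    intro u v hu huv hv
    have h1 := hw₁.nonneg u v hu huv hv
    have h2 := hw₂.nonneg u v hu huv hv
    simp only [hwdef]
    rw [Real.mul_rpow (Real.rpow_nonneg h1 _) (Real.rpow_nonneg h2 _), ← Real.rpow_mul h1,
      ← Real.rpow_mul h2, div_mul_cancel₀ _ hθ0.ne', div_mul_cancel₀ _ hθ0.ne']
  have hwsmall : UnifSmall a b w := by
    intro ρ hρ
    set A := w₁ a b ^ (1 / q / θ) with hA
    have hA0 : 0 ≤ A := Real.rpow_nonneg (hw₁.nonneg a b le_rfl hab le_rfl) _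
    have hs : 0 < 1 / p / θ := div_pos hp' hθ0
    obtain ⟨r, hr, hru⟩ := hws ((ρ / (A + 1)) ^ (1 / (1 / p / θ))) (by positivity)
    refine ⟨r, hr, fun u v hu huv hv hr' => ?_⟩
    have h1 := Real.rpow_le_rpow (hw₁.nonneg u v hu huv hv)
      (hw₁.mono le_rfl hu huv hv le_rfl) (div_pos hq' hθ0).le
    have h2 := Real.rpow_le_rpow (hw₂.nonneg u v hu huv hv) (hru u v hu huv hv hr') hs.le
    rw [← Real.rpow_mul (by positivity), one_div_mul_cancel hs.ne', Real.rpow_one] at h2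
    calc w u v ≤ A * (ρ / (A + 1)) := mul_le_mul h1 h2
          (Real.rpow_nonneg (hw₂.nonneg u v hu huv hv) _) hA0
      _ ≤ ρ := by
        rw [mul_div_assoc', div_le_iff₀ (by positivity)]
        nlinarith
  have hosc : ∀ u v, a ≤ u → u ≤ v → v ≤ b → ∀ s ∈ Icc u v, ∀ s' ∈ Icc u v,
      ‖G s - G s'‖ ≤ c₁ * w₁ u v ^ (1 / q) ∧ ‖ω s - ω s'‖ ≤ c₂ * w₂ u v ^ (1 / p) := by
    intro u v hu huv hv s hs s' hs'
    wlog hss : s' ≤ s generalizing s s'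
    · rw [norm_sub_rev, norm_sub_rev (ω s)]
      exact this s' hs' s hs (le_of_not_ge hss)
    have h1 := hu.trans hs'.1
    have h2 := hs.2.trans hv
    exact ⟨(hG _ _ h1 hss h2).trans (mul_le_mul_of_nonneg_left (Real.rpow_le_rpow
        (hw₁.nonneg _ _ h1 hss h2) (hw₁.mono hu hs'.1 hss hs.2 hv) hq'.le) hc₁),
      (hω _ _ h1 hss h2).trans (mul_le_mul_of_nonneg_left (Real.rpow_le_rpow
        (hw₂.nonneg _ _ h1 hss h2) (hw₂.mono hu hs'.1 hss hs.2 hv) hp'.le) hc₂)⟩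
  obtain ⟨J, hJ⟩ := exists_indefinite_integral (G := G) (ω := ω) hab (hθ ▸ hpq) hw hwsmall
    (mul_nonneg hc₁ hc₂) fun u v hu huv hv s hs s' hs' r hr r' hr' => by
      rw [hwθ u v hu huv hv]
      calc _ ≤ (c₁ * w₁ u v ^ (1 / q)) * (c₂ * w₂ u v ^ (1 / p)) :=
            mul_le_mul (hosc u v hu huv hv s hs s' hs').1 (hosc u v hu huv hv r hr r' hr').2
              (norm_nonneg _) (mul_nonneg hc₁ (Real.rpow_nonneg (hw₁.nonneg u v hu huv hv) _))
        _ = _ := by ring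
  refine ⟨J, fun u v hu huv hv => ⟨?_, (hJ u v hu huv hv).2⟩⟩
  refine (hJ u v hu huv hv).1.trans (le_of_eq ?_)
  rw [hwθ u v hu huv hv]
  ring

end Young

/-! ### Differences of solutions -/

section LocalEstimate

variable {E F : Type*} [NormedAddCommGroup E]

theorem add_rpow_le_two_rpow_mul {a b q : ℝ} (ha : 0 ≤ a) (hb : 0 ≤ b) (hq : 0 < q) :
    (a + b) ^ q ≤ 2 ^ q * (a ^ q + b ^ q) := by
  wlog hab : a ≤ b generalizing a b
  · rw [add_comm a, add_comm (a ^ q)]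
    exact this hb ha (le_of_not_ge hab)
  calc (a + b) ^ q ≤ (2 * b) ^ q := Real.rpow_le_rpow (by positivity) (by linarith) hq.le
    _ = 2 ^ q * b ^ q := Real.mul_rpow zero_le_two hb
    _ ≤ _ := by
      have : 0 ≤ a ^ q := by positivity
      gcongr
      linarith

/-- A path whose increments are dominated by two controls has finite variation, with an
explicit bound. -/
theorem finitePVar_of_norm_le_add {x : ℝ → E} {a b q c₁ c₂ s₁ s₂ : ℝ} {w₁ w₂ : ℝ → ℝ → ℝ}
    (hab : a ≤ b) (hq : 1 ≤ q) (hw₁ : IsCtrl a b w₁) (hw₂ : IsCtrl a b w₂)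
    (hc₁ : 0 ≤ c₁) (hc₂ : 0 ≤ c₂) (hs₁ : 1 ≤ s₁ * q) (hs₂ : 1 ≤ s₂ * q)
    (hx : ∀ u v, a ≤ u → u ≤ v → v ≤ b →
      ‖x v - x u‖ ≤ c₁ * w₁ u v ^ s₁ + c₂ * w₂ u v ^ s₂) :
    FinitePVar q x a b ∧
      varSup q x a b ^ (1 / q) ≤ 2 * (c₁ * w₁ a b ^ s₁ + c₂ * w₂ a b ^ s₂) := by
  have hq0 : 0 < q := by linarith
  have hctrl := (((hw₁.rpow hs₁).const_mul (Real.rpow_nonneg hc₁ q)).add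
    ((hw₂.rpow hs₂).const_mul (Real.rpow_nonneg hc₂ q))).const_mul
      (Real.rpow_nonneg zero_le_two q)
  have heq : ∀ u v, a ≤ u → u ≤ v → v ≤ b →
      2 ^ q * (c₁ ^ q * w₁ u v ^ (s₁ * q) + c₂ ^ q * w₂ u v ^ (s₂ * q)) =
      2 ^ q * ((c₁ * w₁ u v ^ s₁) ^ q + (c₂ * w₂ u v ^ s₂) ^ q) := by
    intro u v hu huv hv
    have h1 := hw₁.nonneg u v hu huv hv
    have h2 := hw₂.nonneg u v hu huv hv
    rw [Real.mul_rpow hc₁ (Real.rpow_nonneg h1 _), Real.mul_rpow hc₂ (Real.rpow_nonneg h2 _),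
      Real.rpow_mul h1, Real.rpow_mul h2]
  have hx' : ∀ u v, a ≤ u → u ≤ v → v ≤ b → ‖x v - x u‖ ^ q ≤
      2 ^ q * (c₁ ^ q * w₁ u v ^ (s₁ * q) + c₂ ^ q * w₂ u v ^ (s₂ * q)) := by
    intro u v hu huv hv
    have h1 := hw₁.nonneg u v hu huv hv
    have h2 := hw₂.nonneg u v hu huv hv
    rw [heq u v hu huv hv]
    exact (Real.rpow_le_rpow (norm_nonneg _) (hx u v hu huv hv) hq0.le).trans
      (add_rpow_le_two_rpow_mul (by positivity) (by positivity) hq0)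
  have hfin := hctrl.finitePVar hx'
  refine ⟨hfin, ?_⟩
  have h1 := hw₁.nonneg a b le_rfl hab le_rfl
  have h2 := hw₂.nonneg a b le_rfl hab le_rfl
  have hsup := hctrl.varSup_le hq0 hab hx'
  simp only [heq a b le_rfl hab le_rfl] at hsup
  have hA : 0 ≤ c₁ * w₁ a b ^ s₁ := by positivity
  have hB : 0 ≤ c₂ * w₂ a b ^ s₂ := by positivity
  have h3 : varSup q x a b ≤ (2 * (c₁ * w₁ a b ^ s₁ + c₂ * w₂ a b ^ s₂)) ^ q := by
    rw [Real.mul_rpow zero_le_two (add_nonneg hA hB)]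
    exact hsup.trans (mul_le_mul_of_nonneg_left (Real.add_rpow_le_rpow_add hA hB hq)
      (by positivity))
  have h4 := Real.rpow_le_rpow ((isCtrl_varSup hq0 hfin).nonneg a b le_rfl hab le_rfl) h3
    (one_div_nonneg.2 hq0.le)
  rwa [← Real.rpow_mul (by positivity), mul_one_div_cancel hq0.ne', Real.rpow_one] at h4

variable [NormedSpace ℝ E] [NormedAddCommGroup F] [NormedSpace ℝ F]

/-- Local stability estimate for the difference `z` of two solutions, on an interval where the
control `w` of the drivers is small. -/
theorem norm_le_of_young_increments [ProperSpace F] {a b p q κ A₁ A₂ A₃ A₄ B₁ B₂ : ℝ}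
    {w k : ℝ → ℝ → ℝ} {z : ℝ → F} {D Γ : ℝ → E →L[ℝ] F} {σ ζ : ℝ → E}
    (hab : a ≤ b) (hp : 1 ≤ p) (hpq : p ≤ q) (hθ : 1 < 1 / p + 1 / q)
    (hw : IsCtrl a b w) (hws : UnifSmall a b w) (hwsub : ∀ u v, a ≤ u → u ≤ v → v ≤ b →
      v - u ≤ w u v) (hk : IsCtrl a b k) (hkA : k a b ^ (1 / q) ≤ A₃)
    (hκ : 0 ≤ κ) (hA₁ : 0 ≤ A₁) (hA₂ : 0 ≤ A₂) (hA₄ : 0 ≤ A₄)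
    (hzc : ContinuousOn z (Icc a b)) (hz : FinitePVar q z a b)
    (hD : ∀ r ∈ Icc a b, ‖D r‖ ≤ A₁ * ‖z r‖)
    (hDD : ∀ u v, a ≤ u → u ≤ v → v ≤ b →
      ‖D v - D u‖ ≤ A₁ * ‖z v - z u‖ + A₂ * k u v ^ (1 / q) * ‖z u‖)
    (hΓ : ∀ r ∈ Icc a b, ‖Γ r‖ ≤ B₁) (hΓv : FinitePVar q Γ a b)
    (hΓB : varSup q Γ a b ^ (1 / q) ≤ B₂)
    (hσ : ∀ u v, a ≤ u → u ≤ v → v ≤ b → ‖σ v - σ u‖ ≤ 2 * w u v ^ (1 / p))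
    (hζ : ∀ u v, a ≤ u → u ≤ v → v ≤ b → ‖ζ v - ζ u‖ ≤ κ * w u v ^ (1 / p))
    (hinc : ∀ Z, (∀ r ∈ Icc a b, ‖z r‖ ≤ Z) → ∀ u v, a ≤ u → u ≤ v → v ≤ b → ∀ v₃ v₄,
      IsYoungIntegral D σ u v v₃ → IsYoungIntegral Γ ζ u v v₄ →
      ‖z v - z u‖ ≤ A₄ * Z * (v - u) + ‖v₃‖ + ‖v₄‖)
    (hw1 : w a b ≤ 1)
    (hsmall : w a b ^ (1 / p) * (A₄ + 2 * A₁ + 4 * sewConst (1 / p + 1 / q) * A₂ * A₃) ≤ 1 / 4)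
    (hsmall' : w a b ^ (1 / p) * (4 * sewConst (1 / p + 1 / q) * A₁) ≤ 1 / 4)
    {r c : ℝ} (hr : r ∈ Icc a b) (hc : c ∈ Icc a b) :
    ‖z r‖ ≤ 2 * ‖z c‖ + 2 * (κ * (B₁ + sewConst (1 / p + 1 / q) * B₂)) := by
  have hp0 : 0 < p := by linarith
  have hq0 : 0 < q := hp0.trans_le hpq
  have hp' : 0 ≤ 1 / p := one_div_nonneg.2 hp0.le
  have hq' : 0 ≤ 1 / q := one_div_nonneg.2 hq0.le
  set S := sewConst (1 / p + 1 / q) with hS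
  have hS0 : 0 < S := sewConst_pos hθ
  obtain ⟨m, hm, hmax⟩ := isCompact_Icc.exists_isMaxOn (nonempty_Icc.2 hab) hzc.norm
  set Z := ‖z m‖ with hZ
  have hZ0 : 0 ≤ Z := norm_nonneg _
  have hzZ : ∀ r ∈ Icc a b, ‖z r‖ ≤ Z := fun r hr => hmax hr
  have hVz := isCtrl_varSup hq0 hz
  set Λ := varSup q z a b ^ (1 / q) with hΛ
  have hΛ0 : 0 ≤ Λ := Real.rpow_nonneg (hVz.nonneg a b le_rfl hab le_rfl) _
  have hkab := hk.nonneg a b le_rfl hab le_rfl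
  have hDv := finitePVar_of_norm_le_add (x := D) (c₁ := A₁) (c₂ := A₂ * Z) (s₁ := 1 / q)
    (s₂ := 1 / q) hab (hp.trans hpq) hVz hk hA₁ (mul_nonneg hA₂ hZ0)
    (one_div_mul_cancel hq0.ne').ge (one_div_mul_cancel hq0.ne').ge
    fun u v hu huv hv => by
      refine (hDD u v hu huv hv).trans (add_le_add
        (mul_le_mul_of_nonneg_left (norm_le_varSup hq0 hz hu huv hv) hA₁) ?_)
      calc A₂ * k u v ^ (1 / q) * ‖z u‖ ≤ A₂ * k u v ^ (1 / q) * Z :=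
            mul_le_mul_of_nonneg_left (hzZ u ⟨hu, huv.trans hv⟩)
              (mul_nonneg hA₂ (Real.rpow_nonneg (hk.nonneg u v hu huv hv) _))
        _ = _ := by ring
  obtain ⟨hDf, hDs⟩ := hDv
  have hDs' : varSup q D a b ^ (1 / q) ≤ 2 * (A₁ * Λ + A₂ * Z * A₃) := by
    refine hDs.trans ?_
    have := mul_le_mul_of_nonneg_left hkA (mul_nonneg hA₂ hZ0)
    linarith
  have young : ∀ {H : ℝ → E →L[ℝ] F} {η : ℝ → E} {C K τ : ℝ}, FinitePVar q H a b →
      varSup q H a b ^ (1 / q) ≤ C → (∀ r ∈ Icc a b, ‖H r‖ ≤ K) → 0 ≤ τ →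
      (∀ u v, a ≤ u → u ≤ v → v ≤ b → ‖η v - η u‖ ≤ τ * w u v ^ (1 / p)) →
      ∀ u v, a ≤ u → u ≤ v → v ≤ b → ∃ y, IsYoungIntegral H η u v y ∧
        ‖y‖ ≤ τ * (K + S * C) * w u v ^ (1 / p) := by
    intro H η C K τ hH hHC hHK hτ hη u v hu huv hv
    have hVH := isCtrl_varSup hq0 hH
    obtain ⟨J, hJ⟩ := exists_young_integral (G := H) (ω := η) (c₁ := 1) (c₂ := τ) hab hp0 hq0
      hθ hVH hw hws zero_le_one hτ
      (fun u v hu huv hv => by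
        rw [one_mul]
        exact norm_le_varSup hq0 hH hu huv hv) hη
    obtain ⟨h1, h2⟩ := hJ u v hu huv hv
    refine ⟨_, h2, ?_⟩
    rw [← hS, one_mul] at h1
    have hw0 : 0 ≤ w u v ^ (1 / p) := Real.rpow_nonneg (hw.nonneg u v hu huv hv) _
    have h3 : varSup q H u v ^ (1 / q) ≤ C := (Real.rpow_le_rpow (hVH.nonneg u v hu huv hv)
      (hVH.mono le_rfl hu huv hv le_rfl) hq').trans hHC
    have h4 : ‖H u (η v - η u)‖ ≤ K * (τ * w u v ^ (1 / p)) :=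
      ((H u).le_opNorm _).trans (mul_le_mul (hHK u ⟨hu, huv.trans hv⟩) (hη u v hu huv hv)
        (norm_nonneg _) ((norm_nonneg _).trans (hHK u ⟨hu, huv.trans hv⟩)))
    have h5 := norm_add_le (J v - J u - H u (η v - η u)) (H u (η v - η u))
    rw [sub_add_cancel] at h5
    have h6 : S * varSup q H u v ^ (1 / q) * (τ * w u v ^ (1 / p)) ≤
        S * C * (τ * w u v ^ (1 / p)) := mul_le_mul_of_nonneg_right
      (mul_le_mul_of_nonneg_left h3 hS0.le) (mul_nonneg hτ hw0)
    calc _ ≤ _ := h5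
      _ ≤ S * C * (τ * w u v ^ (1 / p)) + K * (τ * w u v ^ (1 / p)) := by linarith
      _ = _ := by ring
  set M := A₄ * Z + 2 * (A₁ * Z + S * (2 * (A₁ * Λ + A₂ * Z * A₃))) + κ * (B₁ + S * B₂)
    with hM
  have hA₃ : 0 ≤ A₃ := (Real.rpow_nonneg hkab _).trans hkA
  have hB₁ : 0 ≤ B₁ := (norm_nonneg _).trans (hΓ m hm)
  have hB₂ : 0 ≤ B₂ := (Real.rpow_nonneg
    ((isCtrl_varSup hq0 hΓv).nonneg a b le_rfl hab le_rfl) _).trans hΓB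
  have hM0 : 0 ≤ M := by positivity
  have hbound : ∀ u v, a ≤ u → u ≤ v → v ≤ b → ‖z v - z u‖ ≤ M * w u v ^ (1 / p) := by
    intro u v hu huv hv
    obtain ⟨v₃, hv₃, hn₃⟩ := young hDf hDs' (K := A₁ * Z)
      (fun r hr => (hD r hr).trans (mul_le_mul_of_nonneg_left (hzZ r hr) hA₁)) zero_le_two hσ
      u v hu huv hv
    obtain ⟨v₄, hv₄, hn₄⟩ := young hΓv hΓB hΓ hκ hζ u v hu huv hv
    have h1 := hinc Z hzZ u v hu huv hv v₃ v₄ hv₃ hv₄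
    have hw0 := hw.nonneg u v hu huv hv
    have hw1' : w u v ≤ 1 := (hw.mono le_rfl hu huv hv le_rfl).trans hw1
    have h2 : v - u ≤ w u v ^ (1 / p) := (hwsub u v hu huv hv).trans
      (Real.self_le_rpow_of_le_one hw0 hw1' ((div_le_one hp0).2 hp))
    have h3 := mul_le_mul_of_nonneg_left h2 (mul_nonneg hA₄ hZ0)
    calc _ ≤ _ := h1
      _ ≤ A₄ * Z * w u v ^ (1 / p) +
          2 * (A₁ * Z + S * (2 * (A₁ * Λ + A₂ * Z * A₃))) * w u v ^ (1 / p) +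
          κ * (B₁ + S * B₂) * w u v ^ (1 / p) := by linarith
      _ = M * w u v ^ (1 / p) := by rw [hM]; ring
  have hΛM : Λ ≤ M * w a b ^ (1 / p) := varSup_rpow_le_of_norm_le hq0 hab hw hM0
    (by rwa [one_div_mul_eq_div, one_le_div hp0]) hbound
  have hosc : Z ≤ ‖z c‖ + Λ := by
    have : ‖z m - z c‖ ≤ Λ := by
      rcases le_total c m with h | h
      · exact (norm_le_varSup hq0 hz hc.1 h hm.2).trans (Real.rpow_le_rpow
          (hVz.nonneg _ _ hc.1 h hm.2) (hVz.mono le_rfl hc.1 h hm.2 le_rfl) hq')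
      · rw [norm_sub_rev]
        exact (norm_le_varSup hq0 hz hm.1 h hc.2).trans (Real.rpow_le_rpow
          (hVz.nonneg _ _ hm.1 h hc.2) (hVz.mono le_rfl hm.1 h hc.2 le_rfl) hq')
    have h2 := norm_add_le (z m - z c) (z c)
    rw [sub_add_cancel] at h2
    linarith
  set W := w a b ^ (1 / p) with hW
  have hW0 : 0 ≤ W := Real.rpow_nonneg (hw.nonneg a b le_rfl hab le_rfl) _
  have hW1 : W ≤ 1 := Real.rpow_le_one (hw.nonneg a b le_rfl hab le_rfl) hw1 hp'
  have hκB : 0 ≤ κ * (B₁ + S * B₂) := by positivity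
  have hexp : M * W = W * (A₄ + 2 * A₁ + 4 * S * A₂ * A₃) * Z + W * (4 * S * A₁) * Λ +
      W * (κ * (B₁ + S * B₂)) := by
    rw [hM]
    ring
  have i1 := mul_le_mul_of_nonneg_right hsmall hZ0
  have i2 := mul_le_mul_of_nonneg_right hsmall' hΛ0
  have i3 := mul_le_mul_of_nonneg_right hW1 hκB
  have i4 := hzZ r hr
  have i5 := norm_nonneg (z c)
  linarith

end LocalEstimate

/-! ### Solutions of Young differential equations -/

section Solution

variable {E F : Type*} [NormedAddCommGroup E]

theorem unifSmall_varSup {x : ℝ → E} {a b p q : ℝ} (hp : 0 < p) (hpq : p < q) (hab : a ≤ b)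
    (hc : ContinuousOn x (Icc a b)) (hx : FinitePVar p x a b) : UnifSmall a b (varSup q x) :=
  fun _ hρ => exists_varSup_le_of_sub_le hp hpq hab hc hx hρ

theorem FinitePVar.sub {p a b : ℝ} {x y : ℝ → E} (hp : 1 ≤ p) (hab : a ≤ b)
    (hx : FinitePVar p x a b) (hy : FinitePVar p y a b) :
    FinitePVar p (fun t => x t - y t) a b := by
  have hp0 : 0 < p := by linarith
  refine (finitePVar_of_norm_le_add (c₁ := 1) (c₂ := 1) hab hp (isCtrl_varSup hp0 hx)
    (isCtrl_varSup hp0 hy) zero_le_one zero_le_one (one_div_mul_cancel hp0.ne').ge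
    (one_div_mul_cancel hp0.ne').ge fun u v hu huv hv => ?_).1
  have e1 := norm_le_varSup hp0 hx hu huv hv
  have e2 := norm_le_varSup hp0 hy hu huv hv
  have e3 := norm_sub_le (x v - x u) (y v - y u)
  rw [show x v - y v - (x u - y u) = (x v - x u) - (y v - y u) by abel]
  linarith

variable [NormedSpace ℝ E] [NormedAddCommGroup F] [NormedSpace ℝ F]

/-- `x` solves `dx = f (t, x) dt + g (t, x) dω` on `[0, T]`, in the sense of increments. -/
structure IsYoungSolution (f : ℝ → F → F) (g : ℝ → F → (E →L[ℝ] F)) (ω : ℝ → E) (T : ℝ)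
    (x : ℝ → F) : Prop where
  continuousOn : ContinuousOn x (Icc 0 T)
  increment : ∀ u v, 0 ≤ u → u ≤ v → v ≤ T → ∃ y,
    IsYoungIntegral (fun r => g r (x r)) ω u v y ∧ x v - x u = (∫ r in u..v, f r (x r)) + y

theorem UnifSmall.restrict {a b a' b' : ℝ} {w : ℝ → ℝ → ℝ} (hw : UnifSmall a b w) (ha : a ≤ a')
    (hb : b' ≤ b) : UnifSmall a' b' w := fun ρ hρ => by
  obtain ⟨r, hr, h⟩ := hw ρ hρ
  exact ⟨r, hr, fun u v hu huv hv => h u v (ha.trans hu) huv (hv.trans hb)⟩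

theorem UnifSmall.add {a b : ℝ} {w₁ w₂ : ℝ → ℝ → ℝ} (h₁ : UnifSmall a b w₁)
    (h₂ : UnifSmall a b w₂) : UnifSmall a b (fun u v => w₁ u v + w₂ u v) := fun ρ hρ => by
  obtain ⟨r₁, hr₁, h₁⟩ := h₁ (ρ / 2) (half_pos hρ)
  obtain ⟨r₂, hr₂, h₂⟩ := h₂ (ρ / 2) (half_pos hρ)
  refine ⟨min r₁ r₂, lt_min hr₁ hr₂, fun u v hu huv hv hr => ?_⟩
  have e1 := h₁ u v hu huv hv (hr.trans (min_le_left _ _))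
  have e2 := h₂ u v hu huv hv (hr.trans (min_le_right _ _))
  linarith

theorem UnifSmall.const_mul {a b c : ℝ} {w : ℝ → ℝ → ℝ} (h : UnifSmall a b w) (hc : 0 < c) :
    UnifSmall a b (fun u v => c * w u v) := fun ρ hρ => by
  obtain ⟨r, hr, h⟩ := h (ρ / c) (div_pos hρ hc)
  refine ⟨r, hr, fun u v hu huv hv huvr => ?_⟩
  have := h u v hu huv hv huvr
  rwa [le_div_iff₀' hc] at this

theorem unifSmall_sub {a b : ℝ} : UnifSmall a b (fun u v => v - u) :=
  fun ρ hρ => ⟨ρ, hρ, fun _ _ _ _ _ h => h⟩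

/-- A path satisfying the forward and the backward equation from an initial time is a solution in
the sense of increments. -/
theorem isYoungSolution_of_forward_backward [ProperSpace F] {f : ℝ → F → F}
    {g : ℝ → F → (E →L[ℝ] F)} {ω : ℝ → E} {x : ℝ → F} {T p p' q s : ℝ} {z : F}
    (hp : 0 < p) (hpp' : p < p') (hq : 0 < q) (hθ : 1 < 1 / p' + 1 / q) (hs : s ∈ Icc 0 T)
    (hωc : ContinuousOn ω (Icc 0 T)) (hω : FinitePVar p ω 0 T)
    (hx : ContinuousOn x (Icc 0 T)) (hfx : ContinuousOn (fun r => f r (x r)) (Icc 0 T))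
    (hG : FinitePVar q (fun r => g r (x r)) 0 T)
    (hfwd : ∀ t ∈ Icc s T, x t = z + (∫ u in s..t, f u (x u)) +
      youngIntegral (fun u => g u (x u)) ω s t)
    (hbwd : ∀ t ∈ Icc 0 s, x t = z - (∫ u in t..s, f u (x u)) -
      youngIntegral (fun u => g u (x u)) ω t s) :
    IsYoungSolution f g ω T x := by
  refine ⟨hx, ?_⟩
  have hT : 0 ≤ T := hs.1.trans hs.2
  have hp' := hp.trans hpp'
  have hω' := hω.of_le hp hpp'.le
  obtain ⟨J, hJ⟩ := exists_young_integral (G := fun r => g r (x r)) (c₁ := 1) (c₂ := 1) hT hp' hq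
    hθ (isCtrl_varSup hq hG) (isCtrl_varSup hp' hω') (unifSmall_varSup hp hpp' hT hωc hω)
    zero_le_one zero_le_one
    (fun u v hu huv hv => by rw [one_mul]; exact norm_le_varSup hq hG hu huv hv)
    (fun u v hu huv hv => by rw [one_mul]; exact norm_le_varSup hp' hω' hu huv hv)
  have hxt : ∀ t ∈ Icc 0 T, x t = z + (∫ u in s..t, f u (x u)) + (J t - J s) := by
    intro t ht
    rcases le_total s t with h | h
    · rw [hfwd t ⟨h, ht.2⟩, (hJ s t hs.1 h ht.2).2.youngIntegral_eq h]
    · rw [hbwd t ⟨ht.1, h⟩, (hJ t s ht.1 h hs.2).2.youngIntegral_eq h,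
        intervalIntegral.integral_symm]
      abel
  intro u v hu huv hv
  refine ⟨_, (hJ u v hu huv hv).2, ?_⟩
  have hii : ∀ {α γ}, α ∈ Icc 0 T → γ ∈ Icc 0 T →
      IntervalIntegrable (fun r => f r (x r)) MeasureTheory.volume α γ := fun hα hγ =>
    (hfx.mono (uIcc_subset_Icc hα hγ)).intervalIntegrable
  rw [hxt u ⟨hu, huv.trans hv⟩, hxt v ⟨hu.trans huv, hv⟩,
    ← intervalIntegral.integral_add_adjacent_intervals (hii hs ⟨hu, huv.trans hv⟩)
      (hii ⟨hu, huv.trans hv⟩ ⟨hu.trans huv, hv⟩)]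
  abel

/-- Second-difference estimate for two maps with close, Hölder continuous derivatives. -/
theorem norm_sub_sub_sub_le {H : Type*} [NormedAddCommGroup H] [NormedSpace ℝ H]
    {φ ψ : F → H} {φ' ψ' : F → F →L[ℝ] H} {L M R e δ : ℝ}
    (hφ : ∀ ξ, HasFDerivAt φ (φ' ξ) ξ) (hψ : ∀ ξ, HasFDerivAt ψ (ψ' ξ) ξ)
    (hL : ∀ ξ ξ₁, ‖ψ ξ - ψ ξ₁‖ ≤ L * ‖ξ - ξ₁‖) (he : ∀ ξ, ‖ψ' ξ - φ' ξ‖ ≤ e)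
    (hM : ∀ ξ ξ₁, ‖ξ‖ ≤ 3 * R → ‖ξ₁‖ ≤ 3 * R → ‖ψ' ξ - ψ' ξ₁‖ ≤ M * ‖ξ - ξ₁‖ ^ δ)
    {x y x₁ y₁ : F} (hx : ‖x‖ ≤ R) (hy : ‖y‖ ≤ R) (hx₁ : ‖x₁‖ ≤ R) :
    ‖(ψ y₁ - ψ x₁) - (φ y - φ x)‖ ≤
      L * ‖(y₁ - x₁) - (y - x)‖ + (e + M * ‖x₁ - x‖ ^ δ) * ‖y - x‖ := by
  have h1 := hL y₁ (y + (x₁ - x))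
  have h2 : ‖(ψ y - φ y) - (ψ x - φ x)‖ ≤ e * ‖y - x‖ :=
    convex_univ.norm_image_sub_le_of_norm_hasFDerivWithin_le (f := fun ξ => ψ ξ - φ ξ)
      (fun ξ _ => ((hψ ξ).sub (hφ ξ)).hasFDerivWithinAt) (fun ξ _ => he ξ) (mem_univ x)
      (mem_univ y)
  have h3 : ‖(ψ (y + (x₁ - x)) - ψ y) - (ψ (x + (x₁ - x)) - ψ x)‖ ≤
      M * ‖x₁ - x‖ ^ δ * ‖y - x‖ := by
    refine (convex_closedBall (0 : F) R).norm_image_sub_le_of_norm_hasFDerivWithin_le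
      (f := fun ξ => ψ (ξ + (x₁ - x)) - ψ ξ) (f' := fun ξ => ψ' (ξ + (x₁ - x)) - ψ' ξ)
      (fun ξ _ => ?_) (fun ξ hξ => ?_) (by simpa using hx) (by simpa using hy)
    · exact (((hasFDerivAt_comp_add_right (x₁ - x)).2 (hψ (ξ + (x₁ - x)))).sub (hψ ξ)).hasFDerivWithinAt
    · have hξ' : ‖ξ‖ ≤ R := by simpa using hξ
      have hR : 0 ≤ R := (norm_nonneg _).trans hx
      have e1 := norm_add_le ξ (x₁ - x)
      have e2 := norm_sub_le x₁ x
      have := hM (ξ + (x₁ - x)) ξ (by linarith) (by linarith)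
      rwa [add_sub_cancel_left] at this
  rw [add_sub_cancel] at h3
  have h4 : (ψ y₁ - ψ x₁) - (φ y - φ x) = (ψ y₁ - ψ (y + (x₁ - x))) +
      ((ψ y - φ y) - (ψ x - φ x)) + ((ψ (y + (x₁ - x)) - ψ y) - (ψ x₁ - ψ x)) := by abel
  have h5 : y₁ - (y + (x₁ - x)) = (y₁ - x₁) - (y - x) := by abel
  rw [h5] at h1
  rw [h4]
  have := norm_add₃_le (a := ψ y₁ - ψ (y + (x₁ - x))) (b := (ψ y - φ y) - (ψ x - φ x))
    (c := (ψ (y + (x₁ - x)) - ψ y) - (ψ x₁ - ψ x))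
  linarith

/-- Doubling bounds, propagated along finitely many steps of length at most `r`. -/
theorem le_two_pow_mul_of_local_bound {φ : ℝ → ℝ} {C r : ℝ} :
    ∀ (k : ℕ) (c d : ℝ), |d - c| ≤ k * r →
      (∀ u ∈ uIcc c d, ∀ v ∈ uIcc c d, |v - u| ≤ r → φ v ≤ 2 * φ u + C) →
      φ d ≤ 2 ^ k * (φ c + C) - C := by
  intro k
  induction k with
  | zero =>
    intro c d h _
    have : d = c := by
      rw [Nat.cast_zero, zero_mul] at h
      exact sub_eq_zero.1 (abs_nonpos_iff.1 h)
    simp [this]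
  | succ k ih =>
    intro c d h hloc
    have hk : (0 : ℝ) < k + 1 := by positivity
    push_cast at h
    set e := c + (d - c) * (k / (k + 1)) with he
    have hk1 : (k : ℝ) / (k + 1) ∈ Icc (0 : ℝ) 1 :=
      ⟨by positivity, (div_le_one hk).2 (by linarith)⟩
    have hmem : e ∈ uIcc c d := by
      rw [← segment_eq_uIcc, segment_eq_image']
      exact ⟨_, hk1, by simp only [he, smul_eq_mul]; ring⟩
    have h1 : |e - c| ≤ k * r := by
      have : e - c = (d - c) * (k / (k + 1)) := by rw [he]; ring
      rw [this, abs_mul, abs_of_nonneg hk1.1]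
      calc |d - c| * (k / (k + 1)) ≤ (k + 1) * r * (k / (k + 1)) :=
            mul_le_mul_of_nonneg_right h hk1.1
        _ = k * r := by field_simp
    have h2 : |d - e| ≤ r := by
      have : d - e = (d - c) * (1 / (k + 1)) := by rw [he]; field_simp; ring
      rw [this, abs_mul, abs_of_nonneg (one_div_nonneg.2 hk.le)]
      calc |d - c| * (1 / (k + 1)) ≤ (k + 1) * r * (1 / (k + 1)) :=
            mul_le_mul_of_nonneg_right h (by positivity)
        _ = r := by field_simp
    have hsub : uIcc c e ⊆ uIcc c d := uIcc_subset_uIcc_left hmem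
    have e1 := ih c e h1 fun u hu v hv => hloc u (hsub hu) v (hsub hv)
    have e2 := hloc e hmem d right_mem_uIcc h2
    rw [pow_succ]
    linarith

/-- Continuity argument: an a priori bound `φ ≤ B < 1`, valid as long as `φ ≤ 1`, holds
everywhere. -/
theorem le_of_continuation {φ : ℝ → ℝ} {B : ℝ} (hφ : ContinuousOn φ (Icc 0 1)) (hB : B < 1)
    (h0 : φ 0 ≤ B)
    (hstep : ∀ τ ∈ Icc (0 : ℝ) 1, (∀ σ ∈ Icc 0 τ, φ σ ≤ 1) → φ τ ≤ B) :
    φ 1 ≤ B := by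
  have hcl : IsClosed ({τ | ∀ σ ∈ Icc 0 τ, φ σ ≤ 1} ∩ Icc (0 : ℝ) 1) := by
    refine isClosed_of_closure_subset fun τ hτ => ?_
    have hτ1 : τ ∈ Icc (0 : ℝ) 1 := closure_minimal inter_subset_right isClosed_Icc hτ
    have hlt : ∀ σ, 0 ≤ σ → σ < τ → φ σ ≤ 1 := by
      intro σ hσ hστ
      obtain ⟨τ', h1, h2⟩ := mem_closure_iff.1 hτ (Ioi σ) isOpen_Ioi hστ
      exact h2.1 σ ⟨hσ, le_of_lt h1⟩
    refine ⟨fun σ hσ => ?_, hτ1⟩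
    rcases hσ.2.lt_or_eq with h | rfl
    · exact hlt σ hσ.1 h
    rcases hσ.1.eq_or_lt with h | h
    · rw [← h]
      linarith
    have hc : ContinuousWithinAt φ (Ico 0 σ) σ :=
      (hφ σ hτ1).mono fun r hr => ⟨hr.1, hr.2.le.trans hτ1.2⟩
    have : (nhdsWithin σ (Ico 0 σ)).NeBot := by
      rw [← mem_closure_iff_nhdsWithin_neBot, closure_Ico h.ne]
      exact ⟨h.le, le_rfl⟩
    exact le_of_tendsto hc (Filter.eventually_of_mem self_mem_nhdsWithin
      fun r hr => hlt r hr.1 hr.2)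
  have hall := hcl.Icc_subset_of_forall_exists_gt (a := 0) (b := 1)
    (fun σ hσ => by
      have : σ = 0 := le_antisymm hσ.2 hσ.1
      rw [this]
      linarith) fun τ hτ y hy => by
    have hB' := hstep τ ⟨hτ.2.1, hτ.2.2.le⟩ hτ.1
    have hc := hφ τ ⟨hτ.2.1, hτ.2.2.le⟩
    obtain ⟨ε, hε, hball⟩ := Metric.mem_nhdsWithin_iff.1 (hc (Iio_mem_nhds (hB'.trans_lt hB)))
    have hy' : τ < y := hy
    set τ' := min y (min (τ + ε / 2) 1) with hτ'
    have hlt : τ < τ' := lt_min hy' (lt_min (by linarith) hτ.2.2)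
    refine ⟨τ', fun σ hσ => ?_, hlt, min_le_left _ _⟩
    rcases le_or_gt σ τ with h | h
    · exact hτ.1 σ ⟨hσ.1, h⟩
    have h1 : σ ≤ τ + ε / 2 := hσ.2.trans ((min_le_right _ _).trans (min_le_left _ _))
    have h2 : σ ≤ 1 := hσ.2.trans ((min_le_right _ _).trans (min_le_right _ _))
    have : φ σ < 1 := hball ⟨by rw [Metric.mem_ball, Real.dist_eq, abs_lt]; constructor <;> linarith,
      hσ.1, h2⟩
    exact this.le
  exact hstep 1 ⟨zero_le_one, le_rfl⟩ fun σ hσ =>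
    (hall ⟨zero_le_one, le_rfl⟩ : (1 : ℝ) ∈ {τ | ∀ σ ∈ Icc 0 τ, φ σ ≤ 1}) σ hσ

theorem ContinuousOn.comp_graph {F H : Type*} [TopologicalSpace F] [TopologicalSpace H]
    {φ : ℝ → F → H} {y : ℝ → F} {I : Set ℝ}
    (hφ : ContinuousOn (fun pr : ℝ × F => φ pr.1 pr.2) (I ×ˢ univ)) (hy : ContinuousOn y I) :
    ContinuousOn (fun t => φ t (y t)) I :=
  hφ.comp (continuousOn_id.prodMk hy) fun _ ht => ⟨ht, mem_univ _⟩

/-- The composition of a coefficient, regular in time and Lipschitz in space, with a path of finite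
variation has finite variation. -/
theorem FinitePVar.comp_coeff {g : ℝ → F → (E →L[ℝ] F)} {h : ℝ → ℝ → ℝ} {x : ℝ → F}
    {T q β L : ℝ} (hT : 0 ≤ T) (hq : 1 ≤ q) (hβ : 1 ≤ β * q) (hh : IsCtrl 0 T h) (hL : 0 ≤ L)
    (hgL : ∀ t ∈ Icc (0 : ℝ) T, ∀ ξ ξ₁, ‖g t ξ - g t ξ₁‖ ≤ L * ‖ξ - ξ₁‖)
    (hgh : ∀ s t, 0 ≤ s → s < t → t ≤ T → ∀ ξ, ‖g t ξ - g s ξ‖ ≤ h s t ^ β)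
    (hx : FinitePVar q x 0 T) : FinitePVar q (fun r => g r (x r)) 0 T := by
  have hq0 : 0 < q := by linarith
  refine (finitePVar_of_norm_le_add (c₁ := 1) (c₂ := L) hT hq hh (isCtrl_varSup hq0 hx)
    zero_le_one hL hβ (one_div_mul_cancel hq0.ne').ge fun u v hu huv hv => ?_).1
  have e1 := mul_le_mul_of_nonneg_left (norm_le_varSup hq0 hx hu huv hv) hL
  have e2 := hgL v ⟨hu.trans huv, hv⟩ (x v) (x u)
  have e3 : ‖g v (x u) - g u (x u)‖ ≤ h u v ^ β := by
    rcases huv.eq_or_lt with rfl | huv'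
    · simpa using Real.rpow_nonneg (hh.nonneg u u hu le_rfl hv) β
    · exact hgh u v hu huv' hv (x u)
  have e4 := norm_add_le (g v (x v) - g v (x u)) (g v (x u) - g u (x u))
  rw [sub_add_sub_cancel] at e4
  linarith

theorem exists_local_stability [ProperSpace F] {f : ℝ → F → F} {g : ℝ → F → (E →L[ℝ] F)}
    {g' : ℝ → F → (F →L[ℝ] E →L[ℝ] F)} {h : ℝ → ℝ → ℝ} {ω : ℝ → E} {x : ℝ → F}
    {T p p' q β δ L M N R : ℝ} (hT : 0 ≤ T) (hp : 1 ≤ p) (hpp' : p < p') (hpq : p' ≤ q)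
    (hθ : 1 < 1 / p' + 1 / q) (hβ : 1 ≤ β * q) (hδ0 : 0 < δ) (hδ1 : δ ≤ 1)
    (hL : 0 ≤ L) (hM : 0 ≤ M) (hN : 0 ≤ N) (hh : IsCtrl 0 T h)
    (hf : ContinuousOn (fun pr : ℝ × F => f pr.1 pr.2) (Icc 0 T ×ˢ univ))
    (hg : ContinuousOn (fun pr : ℝ × F => g pr.1 pr.2) (Icc 0 T ×ˢ univ))
    (hg' : ∀ t ∈ Icc (0 : ℝ) T, ∀ ξ, HasFDerivAt (g t) (g' t ξ) ξ)
    (hgL : ∀ t ∈ Icc (0 : ℝ) T, ∀ ξ ξ₁, ‖g t ξ - g t ξ₁‖ ≤ L * ‖ξ - ξ₁‖)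
    (hgM : ∀ t ∈ Icc (0 : ℝ) T, ∀ ξ ξ₁, ‖ξ‖ ≤ 3 * R → ‖ξ₁‖ ≤ 3 * R →
      ‖g' t ξ - g' t ξ₁‖ ≤ M * ‖ξ - ξ₁‖ ^ δ)
    (hgh : ∀ s t, 0 ≤ s → s < t → t ≤ T → ∀ ξ,
      ‖g t ξ - g s ξ‖ + ‖g' t ξ - g' s ξ‖ ≤ h s t ^ β)
    (hfN : ∀ t ∈ Icc (0 : ℝ) T, ∀ ξ ξ₁, ‖ξ‖ ≤ R → ‖ξ₁‖ ≤ R →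
      ‖f t ξ - f t ξ₁‖ ≤ N * ‖ξ - ξ₁‖)
    (hωc : ContinuousOn ω (Icc 0 T)) (hω : FinitePVar p ω 0 T) (hx : IsYoungSolution f g ω T x)
    (hxv : FinitePVar (δ * q) x 0 T) (hxR : ∀ t ∈ Icc (0 : ℝ) T, ‖x t‖ ≤ R) :
    ∃ r, 0 < r ∧ ∃ ρ, 0 < ρ ∧ ∃ K, 0 ≤ K ∧ ∀ κ, 0 < κ → κ ≤ 1 → ∀ (ω' : ℝ → E) (y : ℝ → F),
      ContinuousOn ω' (Icc 0 T) → FinitePVar p ω' 0 T →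
      pVar p (fun t => ω' t - ω t) 0 T ≤ κ * ρ → IsYoungSolution f g ω' T y →
      FinitePVar q y 0 T → ∀ a b, 0 ≤ a → a ≤ b → b ≤ T → b - a ≤ r →
      (∀ t ∈ Icc a b, ‖y t‖ ≤ R) → ∀ u ∈ Icc a b, ∀ v ∈ Icc a b,
        ‖y v - x v‖ ≤ 2 * ‖y u - x u‖ + K * κ := by
  have hp0 : 0 < p := by linarith
  have hp1' : 1 ≤ p' := hp.trans hpp'.le
  have hp0' : 0 < p' := by linarith
  have hq1 : 1 ≤ q := hp1'.trans hpq
  have hq0 : 0 < q := by linarith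
  have hδq : 0 < δ * q := mul_pos hδ0 hq0
  have hxq : FinitePVar q x 0 T := hxv.of_le hδq (by nlinarith)
  have hgh1 : ∀ s t, 0 ≤ s → s < t → t ≤ T → ∀ ξ, ‖g t ξ - g s ξ‖ ≤ h s t ^ β :=
    fun s t hs hst ht ξ => by
      have := norm_nonneg (g' t ξ - g' s ξ)
      linarith [hgh s t hs hst ht ξ]
  set Γ : ℝ → E →L[ℝ] F := fun t => g t (x t) with hΓ
  have hΓv : FinitePVar q Γ 0 T := hxq.comp_coeff hT hq1 hβ hh hL hgL hgh1
  obtain ⟨B₁, hB₁⟩ := isCompact_Icc.exists_bound_of_continuousOn (hg.comp_graph hx.continuousOn)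
  have hB₁0 : 0 ≤ B₁ := (norm_nonneg _).trans (hB₁ 0 ⟨le_rfl, hT⟩)
  set B₂ := varSup q Γ 0 T ^ (1 / q) with hB₂
  have hΓC := isCtrl_varSup hq0 hΓv
  have hB₂0 : 0 ≤ B₂ := Real.rpow_nonneg (hΓC.nonneg _ _ le_rfl hT le_rfl) _
  have hxC := isCtrl_varSup hδq hxv
  set k : ℝ → ℝ → ℝ := fun u v => h u v ^ (β * q) + varSup (δ * q) x u v with hk
  have hkC : IsCtrl 0 T k := (hh.rpow hβ).add hxC
  set A₃ := k 0 T ^ (1 / q) with hA₃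
  have hA₃0 : 0 ≤ A₃ := Real.rpow_nonneg (hkC.nonneg _ _ le_rfl hT le_rfl) _
  set S := sewConst (1 / p' + 1 / q) with hS
  have hS0 : 0 < S := sewConst_pos hθ
  set C := (N + 2 * L + 4 * S * (1 + M) * A₃) + 4 * S * L with hC
  have hC0 : 0 ≤ C := by positivity
  set e := (1 / (4 * (C + 1))) with he
  have he0 : 0 < e := by positivity
  have he1 : e ≤ 1 := by
    rw [he, div_le_one (by positivity)]
    linarith
  have heC : e * C ≤ 1 / 4 := by
    rw [he, one_div_mul_eq_div, div_le_div_iff₀ (by positivity) (by positivity)]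
    linarith
  set ρ := e ^ p' with hρ
  have hρ0 : 0 < ρ := by positivity
  have hρe : ρ ^ (1 / p') = e := by
    rw [hρ, ← Real.rpow_mul he0.le, mul_one_div_cancel hp0'.ne', Real.rpow_one]
  have hρ1 : ρ ≤ 1 := Real.rpow_le_one he0.le he1 hp0'.le
  obtain ⟨r, hr, hrω⟩ := exists_varSup_le_of_sub_le hp0 hpp' hT hωc hω
    (show 0 < ρ / 3 by positivity)
  refine ⟨min r (ρ / 3), lt_min hr (by positivity), (ρ / 3) ^ (1 / p'), by positivity,
    2 * (B₁ + S * B₂), by positivity, ?_⟩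
  intro κ hκ0 hκ1 ω' y hω'c hω' hωω' hy hyv a b ha hab hb hbr hyR u hu v hv
  set ζ : ℝ → E := fun t => ω' t - ω t with hζ
  have hζv : FinitePVar p ζ 0 T := hω'.sub hp hT hω
  have hζc : ContinuousOn ζ (Icc 0 T) := hω'c.sub hωc
  have hζv' := hζv.of_le hp0 hpp'.le
  have hωv' := hω.of_le hp0 hpp'.le
  have hζC := isCtrl_varSup hp0' hζv'
  have hωC := isCtrl_varSup hp0' hωv'
  have hζsmall : (κ ^ p')⁻¹ * varSup p' ζ 0 T ≤ ρ / 3 := by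
    have h1 := (varSup_rpow_le_varSup_rpow hp0 hpp'.le hT hζv).trans hωω'
    have h2 := Real.rpow_le_rpow (Real.rpow_nonneg (hζC.nonneg _ _ le_rfl hT le_rfl) _) h1 hp0'.le
    rw [← Real.rpow_mul (hζC.nonneg _ _ le_rfl hT le_rfl), one_div_mul_cancel hp0'.ne',
      Real.rpow_one, Real.mul_rpow hκ0.le (by positivity), ← Real.rpow_mul (by positivity),
      one_div_mul_cancel hp0'.ne', Real.rpow_one] at h2
    rwa [inv_mul_le_iff₀ (by positivity)]
  have hκi : 0 < (κ ^ p')⁻¹ := by positivity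
  set w : ℝ → ℝ → ℝ := fun u v => (v - u) + varSup p' ω u v + (κ ^ p')⁻¹ * varSup p' ζ u v with hw
  have hwC : IsCtrl 0 T w := (IsCtrl.sub.add hωC).add (hζC.const_mul hκi.le)
  have hws : UnifSmall 0 T w := (unifSmall_sub.add (unifSmall_varSup hp0 hpp' hT hωc hω)).add
    ((unifSmall_varSup hp0 hpp' hT hζc hζv).const_mul hκi)
  have hωw : ∀ u v, 0 ≤ u → u ≤ v → v ≤ T → ‖ω v - ω u‖ ≤ w u v ^ (1 / p') := by
    intro u v hu huv hv
    refine (norm_le_varSup hp0' hωv' hu huv hv).trans (Real.rpow_le_rpow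
      (hωC.nonneg _ _ hu huv hv) ?_ (by positivity))
    have := mul_nonneg hκi.le (hζC.nonneg u v hu huv hv)
    simp only [hw]
    linarith
  have hζw : ∀ u v, 0 ≤ u → u ≤ v → v ≤ T → ‖ζ v - ζ u‖ ≤ κ * w u v ^ (1 / p') := by
    intro u v hu huv hv
    refine (norm_le_varSup hp0' hζv' hu huv hv).trans ?_
    have h0 := hζC.nonneg u v hu huv hv
    have h1 : (varSup p' ζ u v) ^ (1 / p') =
        κ * ((κ ^ p')⁻¹ * varSup p' ζ u v) ^ (1 / p') := by
      rw [Real.mul_rpow hκi.le h0, Real.inv_rpow (by positivity), ← Real.rpow_mul hκ0.le,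
        mul_one_div_cancel hp0'.ne', Real.rpow_one, mul_inv_cancel_left₀ hκ0.ne']
    rw [h1]
    refine mul_le_mul_of_nonneg_left (Real.rpow_le_rpow (mul_nonneg hκi.le h0) ?_
      (by positivity)) hκ0.le
    have := hωC.nonneg u v hu huv hv
    simp only [hw]
    linarith
  have hwab : w a b ≤ ρ := by
    have h1 := hrω a b ha hab hb (hbr.trans (min_le_left _ _))
    have h2 := hbr.trans (min_le_right _ _)
    have h3 := mul_le_mul_of_nonneg_left (hζC.mono le_rfl ha hab hb le_rfl) hκi.le
    simp only [hw]
    linarith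
  have hwab0 := hwC.nonneg a b ha hab hb
  have hwe : w a b ^ (1 / p') ≤ e := hρe ▸ Real.rpow_le_rpow hwab0 hwab (by positivity)
  have hwe0 : 0 ≤ w a b ^ (1 / p') := Real.rpow_nonneg hwab0 _
  have hsmall : ∀ c, 0 ≤ c → c ≤ C → w a b ^ (1 / p') * c ≤ 1 / 4 := fun c h0 hc =>
    (mul_le_mul hwe hc h0 he0.le).trans heC
  have hab' : Icc a b ⊆ Icc 0 T := Icc_subset_Icc ha hb
  have key := norm_le_of_young_increments (z := fun t => y t - x t)
    (D := fun t => g t (y t) - g t (x t)) (Γ := Γ) (σ := ω') (ζ := ζ) (k := k) (κ := κ)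
    (A₁ := L) (A₂ := 1 + M) (A₃ := A₃) (A₄ := N) (B₁ := B₁) (B₂ := B₂) hab hp1' hpq hθ
    (hwC.restrict ha hb) (hws.restrict ha hb) ?_ (hkC.restrict ha hb) ?_ hκ0.le hL (by positivity)
    hN ((hy.continuousOn.sub hx.continuousOn).mono hab')
    ((hyv.sub hq1 hT hxq).mono hq0 ha hb) (fun r hr => hgL r (hab' hr) _ _) ?_
    (fun r hr => hB₁ r (hab' hr)) (hΓv.mono hq0 ha hb) ?_ ?_
    (fun u v hu huv hv => hζw u v (ha.trans hu) huv (hv.trans hb)) ?_ (hwab.trans hρ1)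
    (hsmall _ (by positivity) (by rw [hC]; linarith [show 0 ≤ 4 * S * L by positivity]))
    (hsmall _ (by positivity) (by
      rw [hC]
      linarith [show 0 ≤ N + 2 * L + 4 * S * (1 + M) * A₃ by positivity])) hv hu
  · linarith [key]
  · intro u v hu huv hv
    have h1 := hωC.nonneg u v (ha.trans hu) huv (hv.trans hb)
    have h2 := mul_nonneg hκi.le (hζC.nonneg u v (ha.trans hu) huv (hv.trans hb))
    simp only [hw]
    linarith
  · exact Real.rpow_le_rpow (hkC.nonneg a b ha hab hb) (hkC.mono le_rfl ha hab hb le_rfl)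
      (by positivity)
  · intro u v hu huv hv
    have hu0 := ha.trans hu
    have hvT := hv.trans hb
    rcases huv.eq_or_lt with rfl | huv'
    · have h0 := Real.rpow_nonneg (hkC.nonneg u u hu0 le_rfl hvT) (1 / q)
      simp only [sub_self, norm_zero, mul_zero, zero_add]
      positivity
    have huT : u ∈ Icc (0 : ℝ) T := ⟨hu0, huv.trans hvT⟩
    have hvT' : v ∈ Icc (0 : ℝ) T := ⟨hu0.trans huv, hvT⟩
    refine (norm_sub_sub_sub_le (e := h u v ^ β) (M := M) (R := R) (δ := δ) (hg' u huT)
      (hg' v hvT') (hgL v hvT') (fun ξ => ?_) (hgM v hvT') (hxR u huT)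
      (hyR u ⟨hu, huv.trans hv⟩) (hxR v hvT')).trans ?_
    · have := norm_nonneg (g v ξ - g u ξ)
      linarith [hgh u v hu0 huv' hvT ξ]
    have hh0 := hh.nonneg u v hu0 huv hvT
    have hx0 := hxC.nonneg u v hu0 huv hvT
    have h1 : h u v ^ β ≤ k u v ^ (1 / q) := by
      have : h u v ^ β = (h u v ^ (β * q)) ^ (1 / q) := by
        rw [← Real.rpow_mul hh0, mul_assoc, mul_one_div_cancel hq0.ne', mul_one]
      rw [this]
      exact Real.rpow_le_rpow (by positivity) (by simp only [hk]; linarith) (by positivity)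
    have h2 : ‖x v - x u‖ ^ δ ≤ k u v ^ (1 / q) := by
      have : ‖x v - x u‖ ^ δ = (‖x v - x u‖ ^ (δ * q)) ^ (1 / q) := by
        rw [← Real.rpow_mul (norm_nonneg _), mul_assoc, mul_one_div_cancel hq0.ne', mul_one]
      rw [this]
      refine Real.rpow_le_rpow (by positivity) ?_ (by positivity)
      have := norm_rpow_le_varSup hδq hxv hu0 huv hvT
      have := Real.rpow_nonneg hh0 (β * q)
      simp only [hk]
      linarith
    have h3 := mul_le_mul_of_nonneg_left h2 hM
    have h4 : h u v ^ β + M * ‖x v - x u‖ ^ δ ≤ (1 + M) * k u v ^ (1 / q) := by linarith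
    exact add_le_add le_rfl (mul_le_mul_of_nonneg_right h4 (norm_nonneg _))
  · exact Real.rpow_le_rpow (hΓC.nonneg a b ha hab hb) (hΓC.mono le_rfl ha hab hb le_rfl)
      (by positivity)
  · intro u v hu huv hv
    have h1 := hωw u v (ha.trans hu) huv (hv.trans hb)
    have h2 := hζw u v (ha.trans hu) huv (hv.trans hb)
    have h3 := mul_le_mul_of_nonneg_right hκ1
      (Real.rpow_nonneg (hwC.nonneg u v (ha.trans hu) huv (hv.trans hb)) (1 / p'))
    have h4 := norm_add_le (ω v - ω u) (ζ v - ζ u)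
    rw [show ω v - ω u + (ζ v - ζ u) = ω' v - ω' u by simp only [hζ]; abel] at h4
    linarith
  · intro Z hZ u v hu huv hv v₃ v₄ hv₃ hv₄
    have hu0 := ha.trans hu
    have hvT := hv.trans hb
    obtain ⟨v₂, hv₂, hxi⟩ := hx.increment u v hu0 huv hvT
    obtain ⟨v₁, hv₁, hyi⟩ := hy.increment u v hu0 huv hvT
    have hsub := IsYoungIntegral.sub_eq huv hv₁ hv₂ hv₃ hv₄
    have hfint : ∀ {X : ℝ → F}, ContinuousOn X (Icc 0 T) →
        IntervalIntegrable (fun r => f r (X r)) MeasureTheory.volume u v := fun hX =>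
      ((hf.comp_graph hX).mono (by
        rw [uIcc_of_le huv]
        exact Icc_subset_Icc hu0 hvT)).intervalIntegrable
    have hI : ‖∫ r in u..v, (f r (y r) - f r (x r))‖ ≤ N * Z * |v - u| := by
      refine intervalIntegral.norm_integral_le_of_norm_le_const fun r hr => ?_
      rw [uIoc_of_le huv] at hr
      have hrab : r ∈ Icc a b := ⟨hu.trans hr.1.le, hr.2.trans hv⟩
      exact (hfN r (hab' hrab) _ _ (hyR r hrab) (hxR r (hab' hrab))).trans
        (mul_le_mul_of_nonneg_left (hZ r hrab) hN)
    rw [abs_of_nonneg (sub_nonneg.2 huv)] at hI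
    have heq : y v - x v - (y u - x u) =
        (∫ r in u..v, (f r (y r) - f r (x r))) + v₃ + v₄ := by
      rw [intervalIntegral.integral_sub (hfint hy.continuousOn) (hfint hx.continuousOn), add_assoc,
        ← hsub]
      rw [show y v - x v - (y u - x u) = (y v - y u) - (x v - x u) by abel, hxi, hyi]
      abel
    have := norm_add₃_le (a := ∫ r in u..v, (f r (y r) - f r (x r))) (b := v₃) (c := v₄)
    rw [← heq] at this
    linarith

end Solution

theorem forall_norm_sub_le_of_local_stability {F : Type*} [NormedAddCommGroup F] {x y : ℝ → F}
    {T R C r : ℝ} {n : ℕ} (hC : 0 ≤ C) (hn : T ≤ n * r)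
    (hx : ContinuousOn x (Icc 0 T)) (hy : ContinuousOn y (Icc 0 T))
    (hxR : ∀ t ∈ Icc (0 : ℝ) T, ‖x t‖ + 1 ≤ R)
    (hloc : ∀ a b, 0 ≤ a → a ≤ b → b ≤ T → b - a ≤ r → (∀ t ∈ Icc a b, ‖y t‖ ≤ R) →
      ∀ u ∈ Icc a b, ∀ v ∈ Icc a b, ‖y v - x v‖ ≤ 2 * ‖y u - x u‖ + C)
    {c : ℝ} (hc : c ∈ Icc 0 T) (hB : 2 ^ n * (‖y c - x c‖ + C) < 1) :
    ∀ d ∈ Icc 0 T, ‖y d - x d‖ ≤ 2 ^ n * (‖y c - x c‖ + C) := by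
  intro d hd
  have hmem : ∀ τ ∈ Icc (0 : ℝ) 1, c + τ * (d - c) ∈ Icc 0 T := fun τ hτ =>
    convex_Icc (0 : ℝ) T |>.add_smul_sub_mem hc hd hτ
  have hφ : ContinuousOn (fun τ => ‖y (c + τ * (d - c)) - x (c + τ * (d - c))‖) (Icc 0 1) :=
    ((hy.sub hx).norm).comp (f := fun τ : ℝ => c + τ * (d - c)) (by fun_prop) hmem
  have h0 : ‖y c - x c‖ ≤ 2 ^ n * (‖y c - x c‖ + C) := by
    have h1 : (1 : ℝ) ≤ 2 ^ n := one_le_pow₀ one_le_two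
    nlinarith [norm_nonneg (y c - x c)]
  have := le_of_continuation hφ hB (by simpa using h0) fun τ hτ hle => by
    have hyR : ∀ t ∈ uIcc c (c + τ * (d - c)), t ∈ Icc 0 T ∧ ‖y t‖ ≤ R := by
      intro t ht
      rw [← segment_eq_uIcc, segment_eq_image'] at ht
      obtain ⟨θ, hθ, rfl⟩ := ht
      have hθτ : θ * τ ∈ Icc 0 τ :=
        ⟨mul_nonneg hθ.1 hτ.1, mul_le_of_le_one_left hτ.1 hθ.2⟩
      have heq : c + θ • (c + τ * (d - c) - c) = c + θ * τ * (d - c) := by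
        rw [smul_eq_mul]
        ring
      have h1 := hle _ hθτ
      have h2 := hmem _ ⟨hθτ.1, hθτ.2.trans hτ.2⟩
      simp only [heq] at h1 ⊢
      refine ⟨h2, ?_⟩
      have h3 := norm_add_le (y (c + θ * τ * (d - c)) - x (c + θ * τ * (d - c)))
        (x (c + θ * τ * (d - c)))
      rw [sub_add_cancel] at h3
      linarith [hxR _ h2]
    have hlen : |c + τ * (d - c) - c| ≤ n * r := by
      refine le_trans ?_ hn
      have h1 := hmem τ hτ
      rw [abs_le]
      constructor <;> linarith [h1.1, h1.2, hc.1, hc.2]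
    have := le_two_pow_mul_of_local_bound (φ := fun t => ‖y t - x t‖) (C := C) n c
      (c + τ * (d - c)) hlen fun u hu v hv huv => by
        have hsub := uIcc_subset_uIcc hu hv
        refine hloc (min u v) (max u v) ?_ min_le_max ?_ ?_ (fun t ht => (hyR t (hsub ht)).2) u
          ⟨min_le_left _ _, le_max_left _ _⟩ v ⟨min_le_right _ _, le_max_right _ _⟩
        · exact le_min (hyR u hu).1.1 (hyR v hv).1.1
        · exact max_le (hyR u hu).1.2 (hyR v hv).1.2
        · rwa [max_sub_min_eq_abs]
    linarith
  simpa using this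

/-- Theorem `contsolution`, continuity of the solution map: under
(H1)–(H3), let `X s t ω z` denote the value at time `t` of the unique finite `q`-variation
path solving the forward equation on `[s,T]` and the backward equation on `[0,s]` with
`X s s ω z = z`. Then `X` is (jointly) continuous in `(s,t,ω,z)`, where the space of drivers
carries the `p`-variation norm `‖·‖_{p-var,[0,T]}`; continuity is expressed in ε-δ form. -/
theorem stmt16
    {d m : ℕ} (p T : ℝ) (hp1 : 1 < p) (hp2 : p < 2) (hT : 0 < T)
    (f : ℝ → Ed d → Ed d) (g : ℝ → Ed d → (Ed m →L[ℝ] Ed d))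
    (hf : ContinuousOn (fun pr : ℝ × Ed d => f pr.1 pr.2) (Set.Icc 0 T ×ˢ Set.univ))
    (hg : ContinuousOn (fun pr : ℝ × Ed d => g pr.1 pr.2) (Set.Icc 0 T ×ˢ Set.univ))
    (Dg : ℝ → Ed d → (Ed d →L[ℝ] Ed m →L[ℝ] Ed d))
    (hDg : ∀ t ∈ Set.Icc (0:ℝ) T, ∀ x : Ed d, HasFDerivAt (g t) (Dg t x) x)
    (β δ Lg : ℝ) (hβ0 : 0 < β) (hβ1 : β ≤ 1) (hδ0 : 0 < δ) (hδ1 : δ ≤ 1) (hLg : 0 < Lg)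
    (h : ℝ → ℝ → ℝ) (hctrl : IsControlOn 0 T h)
    (MN : ℝ → ℝ) (hMN : ∀ N : ℝ, 0 ≤ N → 0 < MN N)
    (H1i : ∀ t ∈ Set.Icc (0:ℝ) T, ∀ x y : Ed d, ‖g t x - g t y‖ ≤ Lg * ‖x - y‖)
    (H1ii : ∀ N : ℝ, 0 ≤ N → ∀ t ∈ Set.Icc (0:ℝ) T, ∀ x y : Ed d, ‖x‖ ≤ N → ‖y‖ ≤ N →
      ‖Dg t x - Dg t y‖ ≤ MN N * ‖x - y‖ ^ δ)
    (H1iii : ∀ s t : ℝ, 0 ≤ s → s < t → t ≤ T → ∀ x : Ed d,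
      ‖g t x - g s x‖ + ‖Dg t x - Dg s x‖ ≤ h s t ^ β)
    (a α : ℝ) (b : ℝ → ℝ) (ha : 0 < a) (hα1 : 1 / 2 ≤ α) (hα2 : α < 1)
    (hbmem : IntervalIntegrable (fun s => |b s| ^ (1 / (1 - α))) MeasureTheory.volume 0 T)
    (LN : ℝ → ℝ) (hLN : ∀ N : ℝ, 0 ≤ N → 0 < LN N)
    (H2i : ∀ N : ℝ, 0 ≤ N → ∀ t ∈ Set.Icc (0:ℝ) T, ∀ x y : Ed d, ‖x‖ ≤ N → ‖y‖ ≤ N →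
      ‖f t x - f t y‖ ≤ LN N * ‖x - y‖)
    (H2ii : ∀ t ∈ Set.Icc (0:ℝ) T, ∀ x : Ed d, ‖f t x‖ ≤ a * ‖x‖ + b t)
    (H3a : p - 1 < δ) (H3b : 1 - 1 / p < β) (H3c : 1 - 1 / p < δ * α)
    (q0 q : ℝ)
    (hq0a : 1 - 1 / p < 1 / q0)
    (hq0b : 1 / q0 < min (min β (δ * α)) (min (δ / p) (1 / 2)))
    (hqa : 1 / (q0 * δ) ≤ 1 / q) (hqb : 1 / q < min α (1 / p))
    (X : ℝ → ℝ → (ℝ → Ed m) → Ed d → Ed d)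
    (hX : ∀ s ∈ Set.Icc (0:ℝ) T, ∀ ω : ℝ → Ed m,
      ContinuousOn ω (Set.Icc 0 T) → FinitePVar p ω 0 T → ∀ z : Ed d,
      ContinuousOn (fun t => X s t ω z) (Set.Icc 0 T) ∧
      FinitePVar q (fun t => X s t ω z) 0 T ∧
      X s s ω z = z ∧
      (∀ t ∈ Set.Icc s T, X s t ω z =
        z + (∫ u in s..t, f u (X s u ω z)) +
          youngIntegral (fun u => g u (X s u ω z)) ω s t) ∧
      (∀ t ∈ Set.Icc (0:ℝ) s, X s t ω z =
        z - (∫ u in t..s, f u (X s u ω z)) -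
          youngIntegral (fun u => g u (X s u ω z)) ω t s)) :
    ∀ s ∈ Set.Icc (0:ℝ) T, ∀ t ∈ Set.Icc (0:ℝ) T, ∀ ω : ℝ → Ed m,
      ContinuousOn ω (Set.Icc 0 T) → FinitePVar p ω 0 T → ∀ z : Ed d,
      ∀ ε : ℝ, 0 < ε → ∃ η : ℝ, 0 < η ∧
        ∀ s' ∈ Set.Icc (0:ℝ) T, ∀ t' ∈ Set.Icc (0:ℝ) T, ∀ ω' : ℝ → Ed m,
          ContinuousOn ω' (Set.Icc 0 T) → FinitePVar p ω' 0 T → ∀ z' : Ed d,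
          |s' - s| < η → |t' - t| < η →
          pVarNorm p (fun u => ω' u - ω u) 0 T < η → ‖z' - z‖ < η →
          ‖X s' t' ω' z' - X s t ω z‖ < ε := by
  have hp0 : 0 < p := by linarith
  have hT0 := hT.le
  have hpinv : 1 / p < 1 := (div_lt_one hp0).2 hp1
  have hq0inv : 0 < 1 / q0 := by linarith
  have hq0pos : 0 < q0 := one_div_pos.1 hq0inv
  have hq0β : 1 / q0 < β := hq0b.trans_le ((min_le_left _ _).trans (min_le_left _ _))
  have hq0half : 1 / q0 < 1 / 2 := hq0b.trans_le ((min_le_right _ _).trans (min_le_right _ _))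
  have hq0two : 2 < q0 := (one_div_lt_one_div hq0pos two_pos).1 hq0half
  have hδq0 : 0 < δ * q0 := mul_pos hδ0 hq0pos
  have hqpos : 0 < q := by
    have h1 : 0 < 1 / (q0 * δ) := by positivity
    exact one_div_pos.1 (h1.trans_le hqa)
  have hqδ : q ≤ δ * q0 := by
    rw [mul_comm]
    exact (one_div_le_one_div (by positivity) hqpos).1 hqa
  have hδq0' : δ * q0 ≤ q0 := mul_le_of_le_one_left hq0pos.le hδ1
  have hβq0 : 1 ≤ β * q0 := ((div_lt_iff₀ hq0pos).1 hq0β).le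
  set i := (1 / p + (1 - 1 / q0)) / 2 with hi
  have hi0 : 0 < i := by linarith [one_div_pos.2 hp0]
  set p' := 1 / i with hp'
  have hp'i : 1 / p' = i := by rw [hp', one_div_one_div]
  have hp'0 : 0 < p' := by positivity
  have hpp' : p < p' := (one_div_lt_one_div hp'0 hp0).1 (by rw [hp'i]; linarith)
  have hp'q : p' ≤ q0 := (one_div_le_one_div hq0pos hp'0).1 (by rw [hp'i]; linarith)
  have hθ : 1 < 1 / p' + 1 / q0 := by rw [hp'i]; linarith
  have hh : IsCtrl 0 T h := ⟨fun u v => hctrl.2.2.2 u v, fun u t v => hctrl.2.2.1 u t v⟩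
  have hgh : ∀ s t, 0 ≤ s → s < t → t ≤ T → ∀ ξ, ‖g t ξ - g s ξ‖ ≤ h s t ^ β :=
    fun s t hs hst ht ξ => by
      have := norm_nonneg (Dg t ξ - Dg s ξ)
      linarith [H1iii s t hs hst ht ξ]
  have hfin : ∀ s ∈ Icc (0 : ℝ) T, ∀ ω : ℝ → Ed m, ContinuousOn ω (Icc 0 T) →
      FinitePVar p ω 0 T → ∀ z, FinitePVar (δ * q0) (fun t => X s t ω z) 0 T :=
    fun s hs ω hωc hω z => (hX s hs ω hωc hω z).2.1.of_le hqpos hqδ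
  have hsol : ∀ s ∈ Icc (0 : ℝ) T, ∀ ω : ℝ → Ed m, ContinuousOn ω (Icc 0 T) →
      FinitePVar p ω 0 T → ∀ z, IsYoungSolution f g ω T (fun t => X s t ω z) := by
    intro s hs ω hωc hω z
    obtain ⟨hc, -, -, hfwd, hbwd⟩ := hX s hs ω hωc hω z
    exact isYoungSolution_of_forward_backward hp0 hpp' hq0pos hθ hs hωc hω hc (hf.comp_graph hc)
      (((hfin s hs ω hωc hω z).of_le hδq0 hδq0').comp_coeff hT0 (by linarith) hβq0 hh hLg.le
        H1i hgh) hfwd hbwd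
  intro s hs t ht ω hωc hω z ε hε
  have hxc := (hX s hs ω hωc hω z).1
  obtain ⟨R₀, hR₀⟩ := isCompact_Icc.exists_bound_of_continuousOn hxc
  have hR₀0 : 0 ≤ R₀ := (norm_nonneg _).trans (hR₀ s hs)
  have hR : 0 ≤ R₀ + 1 := by linarith
  obtain ⟨r, hr, ρ, hρ, K, hK, hstab⟩ := exists_local_stability (R := R₀ + 1) hT0 hp1.le hpp' hp'q
    hθ hβq0 hδ0 hδ1 hLg.le (hMN (3 * (R₀ + 1)) (by positivity)).le (hLN (R₀ + 1) hR).le hh hf hg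
    hDg H1i (H1ii (3 * (R₀ + 1)) (by positivity)) H1iii (H2i (R₀ + 1) hR) hωc hω
    (hsol s hs ω hωc hω z) (hfin s hs ω hωc hω z) fun τ hτ => by linarith [hR₀ τ hτ]
  obtain ⟨n, hn⟩ := exists_nat_ge (T / r)
  rw [div_le_iff₀ hr] at hn
  have hA : (0 : ℝ) < 2 ^ n := by positivity
  set A : ℝ := 2 ^ n
  set ε₁ := min 1 (ε / 2) with hε₁
  have hε₁0 : 0 < ε₁ := lt_min one_pos (half_pos hε)
  set κ := min 1 (ε₁ / (4 * A * (K + 1))) with hκ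
  have hκ0 : 0 < κ := lt_min one_pos (by positivity)
  have hκK : A * (K * κ) ≤ ε₁ / 4 := by
    have h1 : κ * (4 * A * (K + 1)) ≤ ε₁ := (le_div_iff₀ (by positivity)).1 (min_le_right _ _)
    have h2 : 0 ≤ A * κ := by positivity
    linarith
  obtain ⟨η₁, hη₁, hs₁⟩ := Metric.continuousOn_iff.1 hxc s hs (ε₁ / (4 * A)) (by positivity)
  obtain ⟨η₂, hη₂, ht₂⟩ := Metric.continuousOn_iff.1 hxc t ht (ε / 2) (half_pos hε)
  refine ⟨min (min η₁ η₂) (min (κ * ρ) (ε₁ / (4 * A))),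
    lt_min (lt_min hη₁ hη₂) (lt_min (by positivity) (by positivity)), ?_⟩
  intro s' hs' t' ht' ω' hω'c hω' z' hss' htt' hωω' hzz'
  have e1 := hs₁ s' hs' (hss'.trans_le ((min_le_left _ _).trans (min_le_left _ _)))
  have e2 := ht₂ t' ht' (htt'.trans_le ((min_le_left _ _).trans (min_le_right _ _)))
  have e3 := hωω'.trans_le ((min_le_right _ _).trans (min_le_left _ _))
  have e4 := hzz'.trans_le ((min_le_right _ _).trans (min_le_right _ _))
  rw [dist_eq_norm] at e1 e2
  have e5 : pVar p (fun u => ω' u - ω u) 0 T ≤ κ * ρ := by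
    unfold pVarNorm at e3
    have := norm_nonneg (ω' 0 - ω 0)
    linarith
  have hloc := hstab κ hκ0 (min_le_left _ _) ω' (fun u => X s' u ω' z') hω'c hω' e5
    (hsol s' hs' ω' hω'c hω' z') ((hfin s' hs' ω' hω'c hω' z').of_le hδq0 hδq0')
  have hstart : ‖X s' s' ω' z' - X s s' ω z‖ ≤ ε₁ / (4 * A) + ε₁ / (4 * A) := by
    have h1 := norm_sub_le (z' - z) (X s s' ω z - X s s ω z)
    rw [(hX s hs ω hωc hω z).2.2.1] at h1 e1
    rw [(hX s' hs' ω' hω'c hω' z').2.2.1]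
    rw [sub_sub_sub_cancel_right] at h1
    linarith
  have hB : A * (‖X s' s' ω' z' - X s s' ω z‖ + K * κ) < ε₁ := by
    have h1 := mul_le_mul_of_nonneg_left hstart hA.le
    have h2 : A * (ε₁ / (4 * A) + ε₁ / (4 * A)) = ε₁ / 2 := by
      field_simp
      norm_num
    linarith
  have hmain := forall_norm_sub_le_of_local_stability (R := R₀ + 1) (by positivity) hn hxc
    (hX s' hs' ω' hω'c hω' z').1 (fun τ hτ => by linarith [hR₀ τ hτ]) hloc hs'
    (hB.trans_le (min_le_left _ _)) t' ht'
  have h3 := norm_add_le (X s' t' ω' z' - X s t' ω z) (X s t' ω z - X s t ω z)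
  rw [sub_add_sub_cancel] at h3
  have h4 : ε₁ ≤ ε / 2 := min_le_right _ _
  linarith
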